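/- arXiv:0712.0792 — 6 statements merged into one kernel-verified Lean document; each statement's English description precedes it below -/
import Mathlib

section
/- Let U ⊆ ℝ² be a nonempty bounded open set and let f : U → ℂ be a smooth function. Then the following two conditions are equivalent. (1) f has polynomial growth: for every p ∈ ℝ² there exist a compact neighborhood K of p and M ∈ ℕ such that sup_{x ∈ K ∩ U} dist(x, K∖U)^M · |f(x)| < +∞ (with the convention that dist(x, ∅) = 0, so the condition is automatic when K ⊆ U). (2) There exist C, M ∈ ℝ_{>0} such that |f(x)| ≤ C / dist(x, ∂U)^M for every x ∈ U. -/
open Metric Set Topology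

theorem IsOpen.infDist_frontier_pos {E : Type*} [PseudoMetricSpace E] {U : Set E}
    (hU : IsOpen U) (hne : (frontier U).Nonempty) {x : E} (hx : x ∈ U) :
    0 < infDist x (frontier U) :=
  (isClosed_frontier.notMem_iff_infDist_pos hne).1 fun h =>
    (hU.frontier_eq ▸ h : x ∈ closure U \ U).2 hx

theorem infDist_frontier_le_infDist_diff {E : Type*} [NormedAddCommGroup E] [NormedSpace ℝ E]
    [FiniteDimensional ℝ E] {U K : Set E} (hK : (K \ U).Nonempty) {x : E} (hx : x ∈ U) :
    infDist x (frontier U) ≤ infDist x (K \ U) := by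
  obtain ⟨z, hz⟩ := hK
  have hU : U ≠ univ := fun h => hz.2 (h ▸ mem_univ z)
  obtain ⟨y, hy, hxy⟩ := exists_mem_frontier_infDist_compl_eq_dist hx hU
  calc infDist x (frontier U) ≤ dist x y := infDist_le_dist_of_mem hy
    _ = infDist x Uᶜ := hxy.symm
    _ ≤ infDist x (K \ U) := infDist_le_infDist_of_subset (fun _ h => h.2) ⟨z, hz⟩

/-- For a nonnegative function `u` and a function `g ≥ 1`, local bounds of `u` by powers of `g`
on a compact set yield a global one. -/
theorem IsCompact.exists_le_mul_pow_of_locally {X : Type*} [TopologicalSpace X] {S U : Set X}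
    (hS : IsCompact S) {u g : X → ℝ} (hg : ∀ x ∈ U, 1 ≤ g x)
    (hloc : ∀ p ∈ S, ∃ t ∈ 𝓝 p, ∃ N : ℕ, ∃ C : ℝ, 0 ≤ C ∧ ∀ x ∈ t ∩ U, u x ≤ C * g x ^ N) :
    ∃ N : ℕ, ∃ C : ℝ, 0 ≤ C ∧ ∀ x ∈ S ∩ U, u x ≤ C * g x ^ N := by
  refine hS.induction_on
    (p := fun t => ∃ N : ℕ, ∃ C : ℝ, 0 ≤ C ∧ ∀ x ∈ t ∩ U, u x ≤ C * g x ^ N)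
    ⟨0, 0, le_rfl, by simp⟩ ?_ ?_ ?_
  · rintro s t hst ⟨N, C, hC, h⟩
    exact ⟨N, C, hC, fun x hx => h x ⟨hst hx.1, hx.2⟩⟩
  · rintro s t ⟨N, C, hC, h⟩ ⟨N', C', hC', h'⟩
    refine ⟨max N N', max C C', le_max_of_le_left hC, ?_⟩
    rintro x ⟨hx | hx, hxU⟩
    · refine (h x ⟨hx, hxU⟩).trans ?_
      have := hg x hxU
      gcongr
      exacts [le_max_left _ _, le_max_left _ _]
    · refine (h' x ⟨hx, hxU⟩).trans ?_
      have := hg x hxU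
      gcongr
      exacts [le_max_right _ _, le_max_right _ _]
  · intro p hp
    obtain ⟨t, ht, h⟩ := hloc p hp
    exact ⟨t, mem_nhdsWithin_of_mem_nhds ht, h⟩

/-- For a nonempty bounded open set `U ⊆ ℝ²` and a smooth function
`f : U → ℂ`, having polynomial growth (in the sense of compact neighborhoods)
is equivalent to an estimate `‖f x‖ ≤ C / dist(x, ∂U)^M` with `C, M > 0`. -/
theorem polynomial_growth_iff_dist_boundary_estimate
    (U : Set (EuclideanSpace ℝ (Fin 2))) (hUopen : IsOpen U) (hUne : U.Nonempty)
    (hUbd : Bornology.IsBounded U)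
    (f : EuclideanSpace ℝ (Fin 2) → ℂ) (hf : ContDiffOn ℝ (⊤ : ℕ∞) f U) :
    (∀ p : EuclideanSpace ℝ (Fin 2),
        ∃ K : Set (EuclideanSpace ℝ (Fin 2)), IsCompact K ∧ K ∈ nhds p ∧
          ∃ M : ℕ, ∃ C : ℝ, ∀ x ∈ K ∩ U, Metric.infDist x (K \ U) ^ M * ‖f x‖ ≤ C)
      ↔
    (∃ C M : ℝ, 0 < C ∧ 0 < M ∧
        ∀ x ∈ U, ‖f x‖ ≤ C / Metric.infDist x (frontier U) ^ M) := by
  have hne : (frontier U).Nonempty := nonempty_frontier_iff.2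
    ⟨hUne, fun h => NormedSpace.unbounded_univ ℝ (EuclideanSpace ℝ (Fin 2)) (h ▸ hUbd)⟩
  have hpos : ∀ x ∈ U, 0 < infDist x (frontier U) := fun x => hUopen.infDist_frontier_pos hne
  obtain ⟨q, hq⟩ := hne
  obtain ⟨D, hD0, hD⟩ := hUbd.subset_closedBall_lt 0 q
  have hle : ∀ x ∈ U, infDist x (frontier U) ≤ D := fun x hx =>
    (infDist_le_dist_of_mem hq).trans (hD hx)
  constructor
  · intro h
    have hg : ∀ x ∈ U, 1 ≤ 1 + (infDist x (frontier U))⁻¹ := fun x hx => by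
      have := inv_pos.2 (hpos x hx)
      linarith
    obtain ⟨N, C, hC, hN⟩ := hUbd.isCompact_closure.exists_le_mul_pow_of_locally
      (u := fun x => ‖f x‖) hg fun p hp => by
        by_cases hpU : p ∈ U
        · have hfp : ContinuousAt (fun x => ‖f x‖) p :=
            (hf.continuousOn.continuousAt (hUopen.mem_nhds hpU)).norm
          exact ⟨_, hfp.eventually_lt_const (lt_add_one _), 0, ‖f p‖ + 1, by positivity,
            fun x hx => by simpa using hx.1.le⟩
        · obtain ⟨K, -, hK, M, C, hM⟩ := h p
          refine ⟨K, hK, M, |C|, abs_nonneg C, fun x hx => ?_⟩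
          have hd := hpos x hx.2
          have hdK := infDist_frontier_le_infDist_diff (K := K) ⟨p, mem_of_mem_nhds hK, hpU⟩ hx.2
          have hdf : infDist x (frontier U) ^ M * ‖f x‖ ≤ |C| :=
            calc _ ≤ infDist x (K \ U) ^ M * ‖f x‖ := by gcongr
              _ ≤ |C| := (hM x hx).trans (le_abs_self C)
          calc ‖f x‖ ≤ |C| * (infDist x (frontier U))⁻¹ ^ M := by
                rw [inv_pow, ← div_eq_mul_inv, le_div_iff₀ (by positivity), mul_comm]
                exact hdf
            _ ≤ |C| * (1 + (infDist x (frontier U))⁻¹) ^ M := by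
                gcongr
                linarith
    refine ⟨(C + 1) * (D + 1) ^ (N + 1), (N + 1 : ℕ), by positivity, by positivity,
      fun x hx => ?_⟩
    have hd := hpos x hx
    rw [Real.rpow_natCast, mul_div_assoc, ← div_pow]
    calc ‖f x‖ ≤ C * (1 + (infDist x (frontier U))⁻¹) ^ N := hN x ⟨subset_closure hx, hx⟩
      _ ≤ (C + 1) * (1 + (infDist x (frontier U))⁻¹) ^ (N + 1) := by
          gcongr
          · linarith
          · exact hg x hx
          · exact N.le_succ
      _ ≤ (C + 1) * ((D + 1) / infDist x (frontier U)) ^ (N + 1) := by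
          gcongr
          rw [le_div_iff₀ hd, add_mul, inv_mul_cancel₀ hd.ne']
          linarith [hle x hx]
  · rintro ⟨C, M, hC, hM, h⟩ p
    obtain ⟨R, hR0, hR⟩ := hUbd.closure.subset_closedBall_lt 0 p
    refine ⟨closedBall p R, isCompact_closedBall p R, closedBall_mem_nhds p hR0,
      ⌈M⌉₊, C * D ^ ((⌈M⌉₊ : ℝ) - M), fun x hx => ?_⟩
    have hd := hpos x hx.2
    have hsub : frontier U ⊆ closedBall p R \ U := fun y hy =>
      ⟨hR hy.1, (hUopen.frontier_eq ▸ hy : y ∈ closure U \ U).2⟩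
    calc infDist x (closedBall p R \ U) ^ ⌈M⌉₊ * ‖f x‖
        ≤ infDist x (frontier U) ^ ⌈M⌉₊ * (C / infDist x (frontier U) ^ M) := by
          gcongr
          · exact infDist_nonneg
          · exact infDist_le_infDist_of_subset hsub ⟨q, hq⟩
          · exact h x hx.2
      _ = C * infDist x (frontier U) ^ ((⌈M⌉₊ : ℝ) - M) := by
          rw [Real.rpow_sub hd, Real.rpow_natCast]
          ring
      _ ≤ C * D ^ ((⌈M⌉₊ : ℝ) - M) := by
          gcongr
          · exact sub_nonneg.2 (Nat.le_ceil M)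
          · exact hle x hx.2
end

section
/- Let n₁, n₂ ∈ ℤ_{>0} and τ₁, τ₂ ∈ ℝ, and for j = 1, 2 set I_j := {θ ∈ [0, 2π] : cos(τ_j − n_j θ) < 0}. If n₁ ≠ n₂, or if n₁ = n₂ and τ₁ ≢ τ₂ (mod 2π), then I₁ ∖ cl(I₂) ≠ ∅ and I₂ ∖ cl(I₁) ≠ ∅, where cl denotes topological closure in ℝ. -/
open scoped Real

/-- A sum of cosines at equally spaced phases which close up after `n` steps vanishes. -/
theorem sum_cos_equally_spaced_eq_zero (n m : ℕ) (hn : 0 < n) (hnm : ¬ n ∣ m) (c : ℝ) :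
    ∑ k ∈ Finset.range n, Real.cos (c - k * (2 * π * m / n)) = 0 := by
  have hn' : (n : ℝ) ≠ 0 := by positivity
  set r : ℝ := 2 * π * m / n with hr
  have hsin : Real.sin (r / 2) ≠ 0 := by
    intro h0
    obtain ⟨j, hj⟩ := Real.sin_eq_zero_iff.1 h0
    apply hnm
    have hmj : (j : ℝ) * n = m := by
      rw [hr] at hj
      field_simp at hj
      nlinarith [Real.pi_pos]
    have hmj' : j * (n : ℤ) = m := by exact_mod_cast hmj
    exact Int.natCast_dvd_natCast.1 ⟨j, by rw [← hmj', mul_comm]⟩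
  have htel (N : ℕ) : 2 * Real.sin (r / 2) * ∑ k ∈ Finset.range N, Real.cos (c - k * r) =
      Real.sin (c + r / 2) - Real.sin (c + r / 2 - N * r) := by
    induction N with
    | zero => simp
    | succ N ih =>
      rw [Finset.sum_range_succ, mul_add, ih]
      have e₁ : c + r / 2 - N * r = (c - N * r) + r / 2 := by ring
      have e₂ : c + r / 2 - (N + 1 : ℕ) * r = (c - N * r) - r / 2 := by push_cast; ring
      rw [e₁, e₂, Real.sin_add (c - N * r), Real.sin_sub (c - N * r)]
      ring
  have hclose : Real.sin (c + r / 2 - n * r) = Real.sin (c + r / 2) := by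
    have e : (n : ℝ) * r = m * (2 * π) := by rw [hr]; field_simp
    rw [e, Real.sin_sub_nat_mul_two_pi]
  have h := htel n
  rw [hclose, sub_self] at h
  simpa [hsin] using h

theorem exists_cos_neg_cos_pos_of_not_dvd (n₁ n₂ : ℕ) (hn₁ : 0 < n₁) (hn₂ : 0 < n₂) (τ₁ τ₂ : ℝ)
    (hdvd : ¬ n₁ ∣ n₂) :
    ∃ θ : ℝ, Real.cos (τ₁ - n₁ * θ) < 0 ∧ 0 < Real.cos (τ₂ - n₂ * θ) := by
  by_contra! hle
  have h₁ : (0 : ℝ) < n₁ := by positivity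
  have h₂ : (0 : ℝ) < n₂ := by positivity
  have hzero (θ : ℝ) (hθ : Real.cos (τ₁ - n₁ * θ) < 0) : Real.cos (τ₂ - n₂ * θ) = 0 := by
    have hshift (k : ℕ) : Real.cos (τ₂ - n₂ * θ - k * (2 * π * n₂ / n₁)) ≤ 0 := by
      have h := hle (θ + k * (2 * π / n₁)) (by
        have e : τ₁ - n₁ * (θ + k * (2 * π / n₁)) = τ₁ - n₁ * θ - k * (2 * π) := by
          field_simp
          ring
        rwa [e, Real.cos_sub_nat_mul_two_pi])
      have e : τ₂ - n₂ * θ - k * (2 * π * n₂ / n₁) = τ₂ - n₂ * (θ + k * (2 * π / n₁)) := by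
        ring
      rwa [e]
    have h := (Finset.sum_eq_zero_iff_of_nonpos fun k _ => hshift k).1
      (sum_cos_equally_spaced_eq_zero n₁ n₂ hn₁ hdvd (τ₂ - n₂ * θ)) 0 (Finset.mem_range.2 hn₁)
    simpa using h
  have ha := hzero ((τ₁ - π) / n₁) (by
    have e : τ₁ - n₁ * ((τ₁ - π) / n₁) = π := by field_simp; ring
    rw [e, Real.cos_pi]; norm_num)
  have hb := hzero ((τ₁ - π) / n₁ - π / (4 * n₁ * n₂)) (by
    have e : τ₁ - n₁ * ((τ₁ - π) / n₁ - π / (4 * n₁ * n₂)) = π / (4 * n₂) + π := by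
      field_simp; ring
    have h2 : (1 : ℝ) ≤ n₂ := by exact_mod_cast hn₂
    have hlt : π / (4 * n₂) < π / 2 := by
      apply div_lt_div_of_pos_left Real.pi_pos <;> linarith
    have hpos : 0 < π / (4 * n₂) := by positivity
    rw [e, Real.cos_add_pi]
    linarith [Real.cos_pos_of_mem_Ioo ⟨by linarith, hlt⟩])
  have e : τ₂ - n₂ * ((τ₁ - π) / n₁ - π / (4 * n₁ * n₂)) =
      (τ₂ - n₂ * ((τ₁ - π) / n₁)) + π / (4 * n₁) := by
    field_simp; ring
  have h1 : (1 : ℝ) ≤ n₁ := by exact_mod_cast hn₁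
  have hsin : 0 < Real.sin (π / (4 * n₁)) := by
    apply Real.sin_pos_of_pos_of_lt_pi (by positivity)
    exact div_lt_self Real.pi_pos (by linarith)
  rw [e, Real.cos_add, ha, zero_mul, zero_sub, neg_eq_zero, mul_eq_zero] at hb
  have := Real.sin_sq_add_cos_sq (τ₂ - n₂ * ((τ₁ - π) / n₁))
  rcases hb with hb | hb
  · rw [ha, hb] at this; norm_num at this
  · exact hsin.ne' hb

theorem exists_cos_neg_cos_pos_of_two_le (m : ℕ) (hm : 2 ≤ m) (c : ℝ) :
    ∃ x : ℝ, Real.cos x < 0 ∧ 0 < Real.cos (c + m * x) := by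
  have hm' : (2 : ℝ) ≤ m := by exact_mod_cast hm
  have hm0 : (m : ℝ) ≠ 0 := by positivity
  by_contra! hle
  have key (t : ℝ) (h0 : 0 < t) (ht : t < 2 * π) : Real.cos (c + m * (π / 2) + t) ≤ 0 := by
    have h := hle (t / m + π / 2) (by
      rw [Real.cos_add_pi_div_two]
      have : t / m < π := by
        rw [div_lt_iff₀ (by positivity)]
        nlinarith [Real.pi_pos]
      linarith [Real.sin_pos_of_pos_of_lt_pi (show 0 < t / m by positivity) this])
    have e : c + m * (π / 2) + t = c + m * (t / m + π / 2) := by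
      field_simp
      ring
    rwa [e]
  have hπ := Real.pi_pos
  set b := c + m * (π / 2)
  have k₁ := key (π / 2) (by linarith) (by linarith)
  have k₂ := key π (by linarith) (by linarith)
  have k₃ := key (π / 2 + π) (by linarith) (by linarith)
  have k₄ := key (π / 4) (by linarith) (by linarith)
  rw [← add_assoc, Real.cos_add_pi] at k₃
  rw [Real.cos_add_pi_div_two] at k₁ k₃
  rw [Real.cos_add_pi] at k₂
  rw [Real.cos_add, Real.cos_pi_div_four, Real.sin_pi_div_four] at k₄
  have hs : Real.sin b = 0 := by linarith
  have hsq := Real.sin_sq_add_cos_sq b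
  have : 0 < √2 / 2 := by positivity
  rw [hs] at k₄ hsq
  nlinarith

theorem exists_cos_neg_cos_pos_of_not_two_pi_int (c : ℝ) (hc : ¬ ∃ k : ℤ, c = 2 * π * k) :
    ∃ x : ℝ, Real.cos x < 0 ∧ 0 < Real.cos (c + x) := by
  by_contra! hle
  have hclosed : IsClosed {x : ℝ | Real.cos (c + x) ≤ 0} :=
    isClosed_le (by fun_prop) continuous_const
  have hsub : Set.Icc (π / 2) (π / 2 + π) ⊆ {x : ℝ | Real.cos (c + x) ≤ 0} := by
    rw [← closure_Ioo (by linarith [Real.pi_pos])]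
    refine closure_minimal (fun x hx => hle x ?_) hclosed
    exact Real.cos_neg_of_pi_div_two_lt_of_lt hx.1 (by linarith [hx.2])
  have hπ := Real.pi_pos
  have k₁ : Real.cos (c + π / 2) ≤ 0 := hsub ⟨le_rfl, by linarith⟩
  have k₂ : Real.cos (c + (π / 2 + π)) ≤ 0 := hsub ⟨by linarith, le_rfl⟩
  have k₃ : Real.cos (c + π) ≤ 0 := hsub ⟨by linarith, by linarith⟩
  rw [← add_assoc, Real.cos_add_pi, Real.cos_add_pi_div_two] at k₂
  rw [Real.cos_add_pi_div_two] at k₁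
  rw [Real.cos_add_pi] at k₃
  have hs : Real.sin c = 0 := by linarith
  have hcos : Real.cos c = 1 := by
    rcases Real.sin_eq_zero_iff_cos_eq.1 hs with h | h <;> linarith
  obtain ⟨k, hk⟩ := (Real.cos_eq_one_iff c).1 hcos
  exact hc ⟨k, by rw [← hk]; ring⟩

theorem exists_cos_neg_cos_pos (n₁ n₂ : ℕ) (hn₁ : 0 < n₁) (hn₂ : 0 < n₂) (τ₁ τ₂ : ℝ)
    (h : n₁ ≠ n₂ ∨ (n₁ = n₂ ∧ ¬ ∃ k : ℤ, τ₁ = τ₂ + 2 * π * k)) :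
    ∃ θ : ℝ, Real.cos (τ₁ - n₁ * θ) < 0 ∧ 0 < Real.cos (τ₂ - n₂ * θ) := by
  by_cases hdvd : n₁ ∣ n₂
  · obtain ⟨m, rfl⟩ := hdvd
    have h₁ : (n₁ : ℝ) ≠ 0 := by positivity
    have hx : ∃ x : ℝ, Real.cos x < 0 ∧ 0 < Real.cos (τ₂ - m * τ₁ + m * x) := by
      have hm : 0 < m := Nat.pos_of_mul_pos_left hn₂
      rcases (Nat.succ_le_of_lt hm).eq_or_lt with rfl | hm
      · have hc : ¬ ∃ k : ℤ, τ₂ - τ₁ = 2 * π * k := by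
          rintro ⟨k, hk⟩
          rcases h with h | ⟨-, h⟩
          · simp at h
          · exact h ⟨-k, by push_cast; linarith⟩
        simpa using exists_cos_neg_cos_pos_of_not_two_pi_int _ hc
      · exact exists_cos_neg_cos_pos_of_two_le m hm _
    obtain ⟨x, hx₁, hx₂⟩ := hx
    refine ⟨(τ₁ - x) / n₁, ?_, ?_⟩
    · convert hx₁ using 2
      field_simp
      ring
    · convert hx₂ using 2
      push_cast
      field_simp
      ring
  · exact exists_cos_neg_cos_pos_of_not_dvd n₁ n₂ hn₁ hn₂ τ₁ τ₂ hdvd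

theorem I_set_diff_closure_nonempty (n₁ n₂ : ℕ) (hn₁ : 0 < n₁) (hn₂ : 0 < n₂) (τ₁ τ₂ : ℝ)
    (h : n₁ ≠ n₂ ∨ (n₁ = n₂ ∧ ¬ ∃ k : ℤ, τ₁ = τ₂ + 2 * π * k)) :
    ({θ ∈ Set.Icc (0 : ℝ) (2 * π) | Real.cos (τ₁ - n₁ * θ) < 0} \
        closure {θ ∈ Set.Icc (0 : ℝ) (2 * π) | Real.cos (τ₂ - n₂ * θ) < 0}).Nonempty := by
  obtain ⟨θ, hθ₁, hθ₂⟩ := exists_cos_neg_cos_pos n₁ n₂ hn₁ hn₂ τ₁ τ₂ h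
  set j : ℤ := toIcoDiv Real.two_pi_pos 0 θ
  have hmem : θ - j * (2 * π) ∈ Set.Ico 0 (2 * π) := by
    simpa only [zsmul_eq_mul, zero_add] using sub_toIcoDiv_zsmul_mem_Ico Real.two_pi_pos 0 θ
  have hper (n : ℕ) (τ : ℝ) :
      Real.cos (τ - n * (θ - j * (2 * π))) = Real.cos (τ - n * θ) := by
    have e : τ - n * (θ - j * (2 * π)) = τ - n * θ + ((n * j : ℤ) : ℝ) * (2 * π) := by
      push_cast
      ring
    rw [e, Real.cos_add_int_mul_two_pi]
  refine ⟨θ - j * (2 * π), ⟨⟨hmem.1, hmem.2.le⟩, by rwa [hper]⟩, fun hcl => ?_⟩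
  have hclosed : IsClosed {x : ℝ | Real.cos (τ₂ - n₂ * x) ≤ 0} :=
    isClosed_le (by fun_prop) continuous_const
  have hle : Real.cos (τ₂ - n₂ * (θ - j * (2 * π))) ≤ 0 :=
    closure_minimal (fun x hx => hx.2.le) hclosed hcl
  rw [hper] at hle
  exact hle.not_gt hθ₂

/-- For `n₁, n₂ ≥ 1` and `τ₁, τ₂ ∈ ℝ`, set
`I_j = {θ ∈ [0,2π] : cos(τ_j − n_j θ) < 0}`.  If `n₁ ≠ n₂`, or `n₁ = n₂` and
`τ₁ ≢ τ₂ (mod 2π)`, then `I₁ ∖ cl(I₂)` and `I₂ ∖ cl(I₁)` are nonempty. -/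
theorem I_sets_not_nested
    (n₁ n₂ : ℕ) (hn₁ : 0 < n₁) (hn₂ : 0 < n₂) (τ₁ τ₂ : ℝ)
    (h : n₁ ≠ n₂ ∨ (n₁ = n₂ ∧ ¬ ∃ k : ℤ, τ₁ = τ₂ + 2 * π * k)) :
    ({θ ∈ Set.Icc (0 : ℝ) (2 * π) | Real.cos (τ₁ - n₁ * θ) < 0} \
        closure {θ ∈ Set.Icc (0 : ℝ) (2 * π) | Real.cos (τ₂ - n₂ * θ) < 0}).Nonempty
      ∧
    ({θ ∈ Set.Icc (0 : ℝ) (2 * π) | Real.cos (τ₂ - n₂ * θ) < 0} \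
        closure {θ ∈ Set.Icc (0 : ℝ) (2 * π) | Real.cos (τ₁ - n₁ * θ) < 0}).Nonempty := by
  refine ⟨I_set_diff_closure_nonempty n₁ n₂ hn₁ hn₂ τ₁ τ₂ h,
    I_set_diff_closure_nonempty n₂ n₁ hn₂ hn₁ τ₂ τ₁ (h.imp Ne.symm ?_)⟩
  rintro ⟨hn, hτ⟩
  exact ⟨hn.symm, fun ⟨k, hk⟩ => hτ ⟨-k, by push_cast; linarith⟩⟩
end

section
/- Let η > 0, n ∈ ℤ_{>0}, τ ∈ ℝ, let φ̃ be a polar polynomial of order < n, and set φ(z) = η e^{iτ} z^{−n} + φ̃(z). Let θ₀ ∈ ℝ satisfy cos(τ − n θ₀) < 0. Then: (1) there exist ε, r > 0 such that Re φ(z) < 0 for every z in the open sector S(θ₀, ε, r); in particular S(θ₀, ε, r) ⊆ U_{φ,A} for every A > 0; (2) consequently, for every open set U ⊆ ℂ concentrated along θ₀, Re φ is bounded above on U (equivalently, exp(φ) is bounded on U). -/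
open scoped Real

/-- The polar polynomial `z ↦ ∑_{j=1}^n a j * z^(-j)` on `ℂ` (with the usual
convention `0 ^ (-j) = 0`). -/
noncomputable def polarPoly (n : ℕ) (a : ℕ → ℂ) (z : ℂ) : ℂ :=
  ∑ j ∈ Finset.Icc 1 n, a j * z ^ (-(j : ℤ))

/-- The open sector centered at `τ` of amplitude `2ε` and radius `r`. -/
def sector (τ ε r : ℝ) : Set ℂ :=
  {z | ∃ ρ θ : ℝ, 0 < ρ ∧ ρ < r ∧ τ - ε < θ ∧ θ < τ + ε ∧
    z = ρ * Complex.exp (θ * Complex.I)}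

/-- The sector with parameters `τ, ε` contains the direction `θ₀` (mod `2π`). -/
def sectorContains (τ ε θ₀ : ℝ) : Prop :=
  ∃ θ : ℝ, τ - ε < θ ∧ θ < τ + ε ∧ ∃ k : ℤ, θ₀ = θ + 2 * π * k

/-- A set `U ⊆ ℂ` is concentrated along the direction `θ₀`: it is nonempty,
connected, bounded, has `0` on its boundary, and near `0` it is contained in
any open sector containing `θ₀`. -/
def ConcentratedAlong (U : Set ℂ) (θ₀ : ℝ) : Prop :=
  U.Nonempty ∧ IsConnected U ∧ Bornology.IsBounded U ∧ (0 : ℂ) ∈ frontier U ∧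
    ∀ τ ε r : ℝ, 0 < ε → ε ≤ π → 0 < r → sectorContains τ ε θ₀ →
      ∃ W : Set ℂ, IsOpen W ∧ (0 : ℂ) ∈ W ∧ U ∩ W ⊆ sector τ ε r

/-- The set `U_{φ,A} = {z ∈ ℂ∖{0} : Re φ(z) < A}`. -/
def Uset (φ : ℂ → ℂ) (A : ℝ) : Set ℂ :=
  {z | z ≠ 0 ∧ (φ z).re < A}

lemma continuousOn_polarPoly (n : ℕ) (a : ℕ → ℂ) : ContinuousOn (polarPoly n a) {0}ᶜ := by
  unfold polarPoly
  exact continuousOn_finsetSum _ fun j _ =>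
    continuousOn_const.mul (continuousOn_id.zpow₀ _ fun z hz => Or.inl hz)

lemma polarPoly_eq_zpow_mul_sum {n m : ℕ} (hmn : m ≤ n) (a : ℕ → ℂ) {z : ℂ} (hz : z ≠ 0) :
    polarPoly m a z = z ^ (-(n : ℤ)) * ∑ j ∈ Finset.Icc 1 m, a j * z ^ (n - j) := by
  rw [polarPoly, Finset.mul_sum]
  refine Finset.sum_congr rfl fun j hj => ?_
  have hj' : j ≤ n := (Finset.mem_Icc.1 hj).2.trans hmn
  rw [mul_left_comm, ← zpow_natCast z (n - j), ← zpow_add₀ hz, Nat.cast_sub hj']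
  congr 2
  ring

lemma ne_zero_of_mem_sector {τ ε r : ℝ} {z : ℂ} (hz : z ∈ sector τ ε r) : z ≠ 0 := by
  obtain ⟨ρ, θ, hρ, -, -, -, rfl⟩ := hz
  exact mul_ne_zero (Complex.ofReal_ne_zero.2 hρ.ne') (Complex.exp_ne_zero _)

/-- A polar polynomial with leading term `η e^{iτ} z^{-n}` has negative real part near `0` in
every direction `θ₀` with `cos (τ - n θ₀) < 0`. -/
lemma exists_sector_re_neg {η : ℝ} (hη : 0 < η) {n : ℕ} (hn : 0 < n) (τ : ℝ) (a : ℕ → ℂ)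
    {θ₀ : ℝ} (hθ₀ : Real.cos (τ - n * θ₀) < 0) :
    ∃ ε r : ℝ, 0 < ε ∧ ε ≤ π ∧ 0 < r ∧ ∀ z ∈ sector θ₀ ε r,
      ((η : ℂ) * Complex.exp (τ * Complex.I) * z ^ (-(n : ℤ)) + polarPoly (n - 1) a z).re < 0 := by
  let h : ℝ × ℝ → ℝ := fun p =>
    (Complex.exp (((-(n * p.2) : ℝ) : ℂ) * Complex.I) * (η * Complex.exp (τ * Complex.I) +
      ∑ j ∈ Finset.Icc 1 (n - 1), a j * (p.1 * Complex.exp (p.2 * Complex.I)) ^ (n - j))).re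
  have hcont : Continuous h := by fun_prop
  have h_zero : h (0, θ₀) < 0 := by
    have hsum : ∑ j ∈ Finset.Icc 1 (n - 1),
        a j * (((0 : ℝ) : ℂ) * Complex.exp (θ₀ * Complex.I)) ^ (n - j) = 0 := by
      refine Finset.sum_eq_zero fun j hj => ?_
      have hj' := Finset.mem_Icc.1 hj
      rw [Complex.ofReal_zero, zero_mul, zero_pow (by omega), mul_zero]
    have hval : h (0, θ₀) = η * Real.cos (τ - n * θ₀) := by
      simp only [h]
      rw [hsum, add_zero, mul_left_comm, ← Complex.exp_add, ← add_mul, ← Complex.ofReal_add,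
        Complex.re_ofReal_mul, Complex.exp_ofReal_mul_I_re, neg_add_eq_sub]
    rw [hval]
    exact mul_neg_of_pos_of_neg hη hθ₀
  obtain ⟨δ, hδ, hball⟩ := Metric.eventually_nhds_iff.1
    (hcont.continuousAt.eventually_lt continuousAt_const h_zero)
  refine ⟨min δ π, δ, lt_min hδ Real.pi_pos, min_le_right _ _, hδ, ?_⟩
  intro z hz
  have hz₀ := ne_zero_of_mem_sector hz
  obtain ⟨ρ, θ, hρ, hρδ, hθ₁, hθ₂, rfl⟩ := hz
  have hlt : h (ρ, θ) < 0 := by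
    refine hball ?_
    have := min_le_left δ π
    rw [Prod.dist_eq, max_lt_iff, Real.dist_eq, Real.dist_eq, abs_lt, abs_lt]
    refine ⟨⟨?_, ?_⟩, ?_, ?_⟩ <;> dsimp only <;> linarith
  have hpow : ((ρ : ℂ) * Complex.exp (θ * Complex.I)) ^ (-(n : ℤ)) =
      ((ρ ^ n)⁻¹ : ℝ) * Complex.exp (((-(n * θ) : ℝ) : ℂ) * Complex.I) := by
    rw [zpow_neg, zpow_natCast, mul_pow, mul_inv, ← Complex.exp_nat_mul, ← Complex.exp_neg]
    push_cast
    congr 2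
    ring
  rw [polarPoly_eq_zpow_mul_sum (Nat.sub_le n 1) a hz₀, mul_comm _ (_ ^ (-(n : ℤ))), ← mul_add,
    hpow, mul_assoc, Complex.re_ofReal_mul]
  exact mul_neg_of_pos_of_neg (by positivity) hlt

/-- A real function continuous away from `0` which is bounded above near `0` on a bounded set `U`
is bounded above on `U`. -/
lemma exists_forall_le_of_continuousOn_compl_zero {f : ℂ → ℝ} (hf : ContinuousOn f {0}ᶜ)
    {U W : Set ℂ} (hU : Bornology.IsBounded U) (hW : IsOpen W) (h0 : (0 : ℂ) ∈ W) {C : ℝ}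
    (hC : ∀ z ∈ U ∩ W, f z ≤ C) : ∃ B : ℝ, ∀ z ∈ U, f z ≤ B := by
  have hK : IsCompact (closure U \ W) := hU.isCompact_closure.diff hW
  have hK₀ : closure U \ W ⊆ {0}ᶜ := fun z hz h => hz.2 (Set.mem_singleton_iff.1 h ▸ h0)
  obtain ⟨B, hB⟩ := hK.bddAbove_image (hf.mono hK₀)
  refine ⟨max B C, fun z hz => ?_⟩
  by_cases hzW : z ∈ W
  · exact (hC z ⟨hz, hzW⟩).trans (le_max_right _ _)
  · exact (hB (Set.mem_image_of_mem f ⟨subset_closure hz, hzW⟩)).trans (le_max_left _ _)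

/-- If `φ(z) = η e^{iτ} z^{−n} + φ̃(z)` with `η > 0`, `n ≥ 1` and
`φ̃` a polar polynomial of order `< n`, and `cos(τ − nθ₀) < 0`, then `Re φ < 0`
on some open sector around `θ₀` (hence that sector lies in every `U_{φ,A}`),
and `Re φ` is bounded above on every open set concentrated along `θ₀`. -/
theorem re_bddAbove_of_cos_neg
    (η : ℝ) (hη : 0 < η) (n : ℕ) (hn : 0 < n) (τ : ℝ) (a : ℕ → ℂ)
    (φ : ℂ → ℂ)
    (hφ : ∀ z : ℂ, φ z =
      (η : ℂ) * Complex.exp (τ * Complex.I) * z ^ (-(n : ℤ)) + polarPoly (n - 1) a z)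
    (θ₀ : ℝ) (hθ₀ : Real.cos (τ - n * θ₀) < 0) :
    (∃ ε r : ℝ, 0 < ε ∧ ε ≤ π ∧ 0 < r ∧
        (∀ z ∈ sector θ₀ ε r, (φ z).re < 0) ∧
        ∀ A : ℝ, 0 < A → sector θ₀ ε r ⊆ Uset φ A)
      ∧
    (∀ U : Set ℂ, IsOpen U → ConcentratedAlong U θ₀ →
        ∃ B : ℝ, ∀ z ∈ U, (φ z).re ≤ B) := by
  obtain ⟨ε, r, hε, hεπ, hr, hneg⟩ := exists_sector_re_neg hη hn τ a hθ₀
  simp only [← hφ] at hneg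
  refine ⟨⟨ε, r, hε, hεπ, hr, hneg, fun A hA z hz =>
    ⟨ne_zero_of_mem_sector hz, (hneg z hz).trans hA⟩⟩, ?_⟩
  rintro U - ⟨-, -, hbdd, -, hconc⟩
  obtain ⟨W, hW, h0, hUW⟩ := hconc θ₀ ε r hε hεπ hr
    ⟨θ₀, by linarith, by linarith, 0, by simp⟩
  have hcont : ContinuousOn (fun z => (φ z).re) {0}ᶜ := by
    simp only [hφ]
    exact Complex.continuous_re.comp_continuousOn
      ((continuousOn_const.mul (continuousOn_id.zpow₀ _ fun z hz => Or.inl hz)).add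
        (continuousOn_polarPoly _ a))
  exact exists_forall_le_of_continuousOn_compl_zero hcont hbdd hW h0
    fun z hz => (hneg z (hUW hz)).le
end

section
/- Let η > 0, n ∈ ℤ_{>0}, τ ∈ ℝ, let φ̃ be a polar polynomial of order < n, and set φ(z) = η e^{iτ} z^{−n} + φ̃(z). Let θ₀ ∈ ℝ satisfy cos(τ − n θ₀) > 0. Then: (1) for every A > 0 there exist ε, r > 0 such that Re φ(z) > A for every z in the open sector S(θ₀, ε, r), i.e. S(θ₀, ε, r) ∩ U_{φ,A} = ∅; (2) consequently, for every open set U ⊆ ℂ concentrated along θ₀, Re φ is not bounded above on U. -/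
open scoped Real

/-- On the punctured unit disc a polar polynomial of order at most `n` is
`O(‖z‖ ^ (-n))`, with constant the sum of the norms of the coefficients. -/
lemma norm_polarPoly_le (n : ℕ) (a : ℕ → ℂ) {z : ℂ} (hz : z ≠ 0) (hz1 : ‖z‖ ≤ 1) :
    ‖polarPoly n a z‖ ≤ (∑ j ∈ Finset.Icc 1 n, ‖a j‖) * ‖z‖⁻¹ ^ n := by
  have h1 : 1 ≤ ‖z‖⁻¹ := (one_le_inv₀ (norm_pos_iff.2 hz)).2 hz1
  rw [polarPoly, Finset.sum_mul]
  refine norm_sum_le_of_le _ fun j hj => ?_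
  rw [norm_mul, norm_zpow, zpow_neg, zpow_natCast, ← inv_pow]
  gcongr
  exact (Finset.mem_Icc.1 hj).2

/-- The real part of `η e^{iτ} z^{-n}` in polar coordinates. -/
lemma re_leading_term (η τ ρ θ : ℝ) (n : ℕ) :
    ((η : ℂ) * Complex.exp (τ * Complex.I) *
      (ρ * Complex.exp (θ * Complex.I)) ^ (-(n : ℤ))).re =
      η * ρ⁻¹ ^ n * Real.cos (τ - n * θ) := by
  have h : (η : ℂ) * Complex.exp (τ * Complex.I) *
      (ρ * Complex.exp (θ * Complex.I)) ^ (-(n : ℤ)) =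
      ((η * ρ⁻¹ ^ n : ℝ) : ℂ) * Complex.exp ((τ - n * θ : ℝ) * Complex.I) := by
    have he : Complex.exp ((τ - n * θ : ℝ) * Complex.I) =
        Complex.exp (τ * Complex.I) * (Complex.exp (θ * Complex.I) ^ n)⁻¹ := by
      rw [← Complex.exp_nat_mul, ← Complex.exp_neg, ← Complex.exp_add]
      congr 1
      push_cast
      ring
    rw [he, zpow_neg, zpow_natCast, mul_pow, mul_inv]
    push_cast
    rw [inv_pow]
    ring
  rw [h, Complex.re_ofReal_mul, Complex.exp_ofReal_mul_I_re]

/-- If the leading term of `φ` has positive real part in the direction `θ₀`, then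
`Re φ` is arbitrarily large on small sectors around `θ₀`. -/
lemma exists_sector_lt_re
    {η : ℝ} (hη : 0 < η) {n : ℕ} (hn : 0 < n) (τ : ℝ) (a : ℕ → ℂ)
    {θ₀ : ℝ} (hθ₀ : 0 < Real.cos (τ - n * θ₀)) {A : ℝ} (hA : 0 < A) :
    ∃ ε r : ℝ, 0 < ε ∧ ε ≤ π ∧ 0 < r ∧ ∀ z ∈ sector θ₀ ε r,
      A < ((η : ℂ) * Complex.exp (τ * Complex.I) * z ^ (-(n : ℤ)) +
        polarPoly (n - 1) a z).re := by
  obtain ⟨c, hc, hc'⟩ := exists_between hθ₀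
  have hcont : Continuous fun θ : ℝ => Real.cos (τ - n * θ) := by fun_prop
  obtain ⟨δ, hδ, hcos⟩ :=
    Metric.eventually_nhds_iff.1 (hcont.continuousAt.eventually (lt_mem_nhds hc'))
  set M : ℝ := ∑ j ∈ Finset.Icc 1 (n - 1), ‖a j‖ with hM
  have hM0 : 0 ≤ M := Finset.sum_nonneg fun j _ => norm_nonneg _
  have hηc : 0 < η * c := mul_pos hη hc
  refine ⟨min δ π, min 1 (η * c / (M + A)), lt_min hδ Real.pi_pos, min_le_right _ _,
    lt_min one_pos (by positivity), ?_⟩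
  rintro z ⟨ρ, θ, hρ, hρr, hθl, hθr, rfl⟩
  have hρ1 : ρ < 1 := hρr.trans_le (min_le_left _ _)
  have hρM : ρ * (M + A) < η * c :=
    (lt_div_iff₀ (by positivity)).1 (hρr.trans_le (min_le_right _ _))
  have hθ : c < Real.cos (τ - n * θ) := by
    refine hcos ?_
    rw [Real.dist_eq, abs_lt]
    have := min_le_left δ π
    constructor <;> linarith
  have hnorm : ‖(ρ : ℂ) * Complex.exp (θ * Complex.I)‖ = ρ := by
    rw [norm_mul, Complex.norm_exp_ofReal_mul_I, mul_one, Complex.norm_real,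
      Real.norm_of_nonneg hρ.le]
  have hpoly := norm_polarPoly_le (n - 1) a
    (norm_pos_iff.1 (hnorm.symm ▸ hρ)) (hnorm.trans_le hρ1.le)
  rw [hnorm, ← hM] at hpoly
  have hre := (abs_le.1 ((Complex.abs_re_le_norm _).trans hpoly)).1
  rw [Complex.add_re, re_leading_term]
  set P : ℝ := ρ⁻¹ ^ (n - 1) with hP
  have hP1 : 1 ≤ P := one_le_pow₀ ((one_le_inv₀ hρ).2 hρ1.le)
  have hPn : ρ⁻¹ ^ n = P * ρ⁻¹ := by rw [hP, ← pow_succ, Nat.sub_add_cancel hn]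
  have hlead : P * (M + A) < η * ρ⁻¹ ^ n * Real.cos (τ - n * θ) := by
    calc P * (M + A) < P * (η * c / ρ) := by
          gcongr
          rwa [lt_div_iff₀ hρ, mul_comm]
      _ = η * ρ⁻¹ ^ n * c := by rw [hPn]; ring
      _ ≤ η * ρ⁻¹ ^ n * Real.cos (τ - n * θ) := by gcongr
  nlinarith

/-- Every sector around `θ₀` of amplitude at most `2π` meets every set concentrated
along `θ₀`. -/
lemma ConcentratedAlong.inter_sector_nonempty {U : Set ℂ} {θ₀ : ℝ}
    (hU : ConcentratedAlong U θ₀) {ε r : ℝ} (hε : 0 < ε) (hεπ : ε ≤ π) (hr : 0 < r) :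
    (U ∩ sector θ₀ ε r).Nonempty := by
  obtain ⟨-, -, -, h0, hsec⟩ := hU
  obtain ⟨W, hWo, hW0, hWs⟩ := hsec θ₀ ε r hε hεπ hr
    ⟨θ₀, by linarith, by linarith, 0, by simp⟩
  obtain ⟨z, hzW, hzU⟩ := mem_closure_iff.1 (frontier_subset_closure h0) W hWo hW0
  exact ⟨z, hzU, hWs ⟨hzU, hzW⟩⟩

/-- If `φ(z) = η e^{iτ} z^{−n} + φ̃(z)` with `η > 0`, `n ≥ 1` and
`φ̃` a polar polynomial of order `< n`, and `cos(τ − nθ₀) > 0`, then for every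
`A > 0` there is an open sector around `θ₀` on which `Re φ > A` (i.e. disjoint
from `U_{φ,A}`), and `Re φ` is not bounded above on any open set concentrated
along `θ₀`. -/
theorem re_not_bddAbove_of_cos_pos
    (η : ℝ) (hη : 0 < η) (n : ℕ) (hn : 0 < n) (τ : ℝ) (a : ℕ → ℂ)
    (φ : ℂ → ℂ)
    (hφ : ∀ z : ℂ, φ z =
      (η : ℂ) * Complex.exp (τ * Complex.I) * z ^ (-(n : ℤ)) + polarPoly (n - 1) a z)
    (θ₀ : ℝ) (hθ₀ : 0 < Real.cos (τ - n * θ₀)) :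
    (∀ A : ℝ, 0 < A → ∃ ε r : ℝ, 0 < ε ∧ ε ≤ π ∧ 0 < r ∧
        (∀ z ∈ sector θ₀ ε r, A < (φ z).re) ∧
        sector θ₀ ε r ∩ Uset φ A = ∅)
      ∧
    (∀ U : Set ℂ, IsOpen U → ConcentratedAlong U θ₀ →
        ¬ ∃ B : ℝ, ∀ z ∈ U, (φ z).re ≤ B) := by
  have key : ∀ A : ℝ, 0 < A → ∃ ε r : ℝ, 0 < ε ∧ ε ≤ π ∧ 0 < r ∧
      ∀ z ∈ sector θ₀ ε r, A < (φ z).re := by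
    intro A hA
    simpa only [hφ] using exists_sector_lt_re hη hn τ a hθ₀ hA
  refine ⟨fun A hA => ?_, ?_⟩
  · obtain ⟨ε, r, hε, hεπ, hr, h⟩ := key A hA
    refine ⟨ε, r, hε, hεπ, hr, h, Set.eq_empty_of_forall_notMem ?_⟩
    rintro z ⟨hzS, -, hzA⟩
    exact lt_asymm hzA (h z hzS)
  · rintro U - hU ⟨B, hB⟩
    obtain ⟨ε, r, hε, hεπ, hr, h⟩ := key (max B 1) (by positivity)
    obtain ⟨z, hzU, hzS⟩ := hU.inter_sector_nonempty hε hεπ hr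
    exact (hB z hzU).not_gt ((le_max_left B 1).trans_lt (h z hzS))
end

section
/- For every n ∈ ℤ_{>0} and τ₀ ∈ ℝ there exists τ ∈ ℝ (depending only on n and τ₀) with the following property: for every ρ > 0 and every polar polynomial φ̃ of order < n, setting φ(z) := ρ e^{iτ₀} z^{−n} + φ̃(z), there exist open sets U₀, …, U_{2n−1} ⊆ ℂ such that for each j ∈ {0, …, 2n−1}: (1) U_j is concentrated along τ + jπ/n, and (2) both Re φ and −Re φ are bounded above on U_j (equivalently, both exp(φ) and exp(−φ) are bounded on U_j). -/
open scoped Real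

open Filter Topology

/-- If the argument of `z * exp (-θ₀ * I)` tends to `0` as `z → 0` within `U`, then near `0` the
set `U` lies in every open sector containing `θ₀`. -/
theorem exists_inter_subset_sector {U : Set ℂ} {θ₀ : ℝ} (h0 : (0 : ℂ) ∉ U)
    (harg : Tendsto (fun z : ℂ ↦ (z / Complex.exp (θ₀ * Complex.I)).arg) (𝓝[U] 0) (𝓝 0))
    {τ ε r : ℝ} (hr : 0 < r) (hs : sectorContains τ ε θ₀) :
    ∃ W : Set ℂ, IsOpen W ∧ (0 : ℂ) ∈ W ∧ U ∩ W ⊆ sector τ ε r := by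
  obtain ⟨θ, h1, h2, k, hk⟩ := hs
  have hev : ∀ᶠ z : ℂ in 𝓝 0, ‖z‖ < r ∧
      (z ∈ U → (z / Complex.exp (θ₀ * Complex.I)).arg ∈ Set.Ioo (τ - ε - θ) (τ + ε - θ)) := by
    refine .and ?_ (eventually_nhdsWithin_iff.1
      (harg.eventually (Ioo_mem_nhds (by linarith) (by linarith))))
    filter_upwards [Metric.ball_mem_nhds (0 : ℂ) hr] with z hz using mem_ball_zero_iff.1 hz
  obtain ⟨W, hW, hWo, hW0⟩ := eventually_nhds_iff.1 hev
  refine ⟨W, hWo, hW0, fun z ⟨hzU, hzW⟩ ↦ ?_⟩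
  obtain ⟨hzr, hz⟩ := hW z hzW
  have hz := hz hzU
  have hz0 : z ≠ 0 := fun h ↦ h0 (h ▸ hzU)
  refine ⟨‖z‖, θ + (z / Complex.exp (θ₀ * Complex.I)).arg, norm_pos_iff.2 hz0, hzr,
    by linarith [hz.1], by linarith [hz.2], ?_⟩
  have he : Complex.exp (θ₀ * Complex.I) = Complex.exp (θ * Complex.I) := by
    rw [Complex.exp_eq_exp_iff_exists_int]
    refine ⟨k, ?_⟩
    rw [hk]
    push_cast
    ring
  have key := Complex.norm_mul_exp_arg_mul_I (z / Complex.exp (θ₀ * Complex.I))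
  rw [norm_div, Complex.norm_exp_ofReal_mul_I, div_one, eq_div_iff (Complex.exp_ne_zero _)] at key
  push_cast
  rw [add_mul, Complex.exp_add, ← he]
  linear_combination -key

/-- The cuspidal region of points `x + i y` with `0 < x < r` and `|y| < x ^ (n + 1)`. -/
def cusp (n : ℕ) (r : ℝ) : Set ℂ :=
  {w | 0 < w.re ∧ w.re < r ∧ |w.im| < w.re ^ (n + 1)}

theorem isOpen_cusp (n : ℕ) (r : ℝ) : IsOpen (cusp n r) :=
  (isOpen_lt continuous_const Complex.continuous_re).inter
    ((isOpen_lt Complex.continuous_re continuous_const).inter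
      (isOpen_lt Complex.continuous_im.abs (Complex.continuous_re.pow _)))

theorem ofReal_mem_cusp {n : ℕ} {r x : ℝ} (hx : 0 < x) (hxr : x < r) : (x : ℂ) ∈ cusp n r :=
  ⟨by simpa, by simpa, by simpa using pow_pos hx _⟩

theorem isConnected_cusp (n : ℕ) {r : ℝ} (hr : 0 < r) : IsConnected (cusp n r) := by
  have himage : cusp n r = (fun p : ℝ × ℝ ↦ (p.1 : ℂ) + (p.2 * p.1 ^ (n + 1) : ℝ) * Complex.I) ''
      (Set.Ioo 0 r ×ˢ Set.Ioo (-1) 1) := by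
    ext w
    constructor
    · rintro ⟨h0, hr, him⟩
      have hp := pow_pos h0 (n + 1)
      obtain ⟨h1, h2⟩ := abs_lt.1 him
      refine ⟨(w.re, w.im / w.re ^ (n + 1)), ⟨⟨h0, hr⟩, ?_, ?_⟩, ?_⟩
      · rw [lt_div_iff₀ hp]; linarith
      · rw [div_lt_iff₀ hp]; linarith
      · simp only [div_mul_cancel₀ _ hp.ne']
        exact Complex.re_add_im w
    · rintro ⟨⟨s, u⟩, ⟨⟨h0, hr⟩, h1, h2⟩, rfl⟩
      have hp := pow_pos h0 (n + 1)
      have hre : ((s : ℂ) + (u * s ^ (n + 1) : ℝ) * Complex.I).re = s := by simp [-Complex.ofReal_mul]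
      have him : ((s : ℂ) + (u * s ^ (n + 1) : ℝ) * Complex.I).im = u * s ^ (n + 1) := by
        simp [-Complex.ofReal_mul]
      simp only [cusp, Set.mem_ofPred_eq, hre, him]
      refine ⟨h0, hr, ?_⟩
      rw [abs_mul, abs_of_pos hp]
      exact mul_lt_of_lt_one_left hp (abs_lt.2 ⟨h1, h2⟩)
  rw [himage]
  refine IsConnected.image ⟨⟨(r / 2, 0), ?_⟩, ?_⟩ _ (by fun_prop)
  · simp [hr]
  · exact isPreconnected_Ioo.prod isPreconnected_Ioo

theorem zero_mem_closure_cusp (n : ℕ) {r : ℝ} (hr : 0 < r) : (0 : ℂ) ∈ closure (cusp n r) := by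
  have h : Tendsto (fun x : ℝ ↦ (x : ℂ)) (𝓝[>] 0) (𝓝 0) :=
    (Complex.continuous_ofReal.tendsto' 0 0 rfl).mono_left nhdsWithin_le_nhds
  refine mem_closure_of_tendsto h ?_
  filter_upwards [Ioo_mem_nhdsGT hr] with x hx using ofReal_mem_cusp hx.1 hx.2

theorem norm_lt_of_mem_cusp {n : ℕ} {r : ℝ} (hr : r ≤ 1) {w : ℂ} (hw : w ∈ cusp n r) :
    ‖w‖ < 2 * r := by
  obtain ⟨h0, h1, h2⟩ := hw
  have := Complex.norm_le_abs_re_add_abs_im w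
  have : w.re ^ (n + 1) ≤ w.re := pow_le_of_le_one h0.le (by linarith) (by simp)
  rw [abs_of_pos h0] at *
  linarith

theorem norm_div_re_sub_one_le {n : ℕ} {r : ℝ} {w : ℂ} (hw : w ∈ cusp n r) :
    ‖w / w.re - 1‖ ≤ w.re ^ n := by
  obtain ⟨h0, h1, h2⟩ := hw
  have hc : (w.re : ℂ) ≠ 0 := by exact_mod_cast h0.ne'
  have : w / w.re - 1 = (w.im : ℂ) * Complex.I / w.re := by
    rw [div_sub_one hc]
    congr 1
    nth_rewrite 1 [← Complex.re_add_im w]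
    ring
  rw [this, norm_div, norm_mul, Complex.norm_I, mul_one, Complex.norm_real, Complex.norm_real,
    Real.norm_eq_abs, Real.norm_eq_abs, abs_of_pos h0, div_le_iff₀ h0, ← pow_succ]
  exact h2.le

theorem norm_pow_sub_one_le {v : ℂ} (hv : ‖v‖ ≤ 1) (n : ℕ) : ‖v ^ n - 1‖ ≤ n * ‖v - 1‖ := by
  rw [← geom_sum_mul, norm_mul]
  gcongr
  refine (norm_sum_le _ _).trans ?_
  calc ∑ i ∈ Finset.range n, ‖v ^ i‖ ≤ ∑ i ∈ Finset.range n, (1 : ℝ) := by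
        gcongr with i
        rw [norm_pow]
        exact pow_le_one₀ (norm_nonneg _) hv
    _ = n := by simp

/-- If `D` is purely imaginary then `w ↦ Re (D * w ^ (-n))` is bounded on the cusp. -/
theorem abs_re_mul_zpow_le {n : ℕ} {r : ℝ} {D w : ℂ} (hD : D.re = 0) (hw : w ∈ cusp n r) :
    |(D * w ^ (-(n : ℤ))).re| ≤ ‖D‖ * n := by
  have h0 : 0 < w.re := hw.1
  have hc : (w.re : ℂ) ≠ 0 := by exact_mod_cast h0.ne'
  have hw0 : w ≠ 0 := fun h ↦ by simp [h] at h0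
  set v : ℂ := w.re / w with hv
  have hv1 : ‖v‖ ≤ 1 := by
    rw [hv, norm_div, Complex.norm_real]
    exact div_le_one_of_le₀ (Complex.abs_re_le_norm w) (norm_nonneg _)
  have hvsub : ‖v - 1‖ ≤ w.re ^ n := by
    have : v - 1 = -(v * (w / w.re - 1)) := by
      rw [hv]; field_simp; ring
    rw [this, norm_neg, norm_mul]
    exact (mul_le_of_le_one_left (norm_nonneg _) hv1).trans (norm_div_re_sub_one_le hw)
  have hp : 0 < w.re ^ n := pow_pos h0 n
  have hre : ((((w.re ^ n)⁻¹ : ℝ) : ℂ) * D).re = 0 := by rw [Complex.re_ofReal_mul, hD, mul_zero]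
  have heq : D * w ^ (-(n : ℤ)) = (((w.re ^ n)⁻¹ : ℝ) : ℂ) * D * (v ^ n - 1)
      + (((w.re ^ n)⁻¹ : ℝ) : ℂ) * D := by
    rw [hv, zpow_neg, zpow_natCast, div_pow]
    push_cast
    field_simp
    ring
  rw [heq, Complex.add_re, hre, add_zero]
  refine (Complex.abs_re_le_norm _).trans ?_
  rw [norm_mul, norm_mul, Complex.norm_real, Real.norm_eq_abs, abs_of_pos (inv_pos.2 hp)]
  calc (w.re ^ n)⁻¹ * ‖D‖ * ‖v ^ n - 1‖ ≤ (w.re ^ n)⁻¹ * ‖D‖ * (n * w.re ^ n) := by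
        gcongr
        exact (norm_pow_sub_one_le hv1 n).trans (by gcongr)
    _ = ‖D‖ * n := by field_simp

/-- If `φ z = C * (z * k z) ^ (-n)` near `0` with `k` analytic and `k 0 = 1`, then `Re φ` is bounded
on an open set concentrated along any direction `θ` such that `C * exp (-i n θ)` is purely
imaginary: the preimage of a rotated cusp under the local coordinate `z * k z`. -/
theorem exists_concentratedAlong_abs_re_le {n : ℕ} (hn : 0 < n) {C : ℂ} {θ : ℝ}
    (hC : (C * Complex.exp (θ * Complex.I) ^ (-(n : ℤ))).re = 0) {k φ : ℂ → ℂ}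
    (hk : AnalyticAt ℂ k 0) (hk0 : k 0 = 1)
    (hφ : ∀ᶠ z in 𝓝[≠] 0, φ z = C * (z * k z) ^ (-(n : ℤ))) :
    ∃ U : Set ℂ, IsOpen U ∧ ConcentratedAlong U θ ∧ ∃ B : ℝ, ∀ z ∈ U, |(φ z).re| ≤ B := by
  set e : ℂ := Complex.exp (θ * Complex.I) with he
  have he0 : e ≠ 0 := Complex.exp_ne_zero _
  have hen : ‖e‖ = 1 := Complex.norm_exp_ofReal_mul_I θ
  set g : ℂ → ℂ := fun z ↦ z * k z with hg
  have hgs : HasStrictDerivAt g 1 0 := by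
    have := (hasStrictDerivAt_id (0 : ℂ)).mul hk.hasStrictDerivAt
    simp only [hk0, id, one_mul, zero_mul, add_zero] at this
    exact this
  have hg0 : g 0 = 0 := by simp [hg]
  set f := hgs.hasStrictFDerivAt_equiv one_ne_zero |>.toOpenPartialHomeomorph g with hf
  have hfg : ∀ z, f z = g z := fun z ↦ rfl
  have h0s : (0 : ℂ) ∈ f.source :=
    (hgs.hasStrictFDerivAt_equiv one_ne_zero).mem_toOpenPartialHomeomorph_source
  have h0t : (0 : ℂ) ∈ f.target := by simpa [hfg, hg0] using f.map_source h0s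
  have hsymm0 : f.symm 0 = 0 := by simpa [hfg, hg0] using f.left_inv h0s
  have hsymmc : ContinuousAt f.symm 0 := f.continuousAt_symm h0t
  have hgood : ∀ᶠ ζ in 𝓝 (0 : ℂ), ζ ∈ f.target ∧ ‖f.symm ζ‖ < 1 ∧
      (f.symm ζ ≠ 0 → k (f.symm ζ) ≠ 0 ∧ φ (f.symm ζ) = C * g (f.symm ζ) ^ (-(n : ℤ))) := by
    refine (f.open_target.eventually_mem h0t).and ?_
    have htend : Tendsto f.symm (𝓝 0) (𝓝 0) := by simpa [ContinuousAt, hsymm0] using hsymmc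
    have hkne : ∀ᶠ z in 𝓝 (0 : ℂ), k z ≠ 0 := hk.continuousAt.eventually_ne (by simp [hk0])
    refine htend.eventually (p := fun z ↦ ‖z‖ < 1 ∧
      (z ≠ 0 → k z ≠ 0 ∧ φ z = C * g z ^ (-(n : ℤ)))) (.and ?_ ?_)
    · filter_upwards [Metric.ball_mem_nhds (0 : ℂ) one_pos] with z hz using mem_ball_zero_iff.1 hz
    · filter_upwards [hkne, eventually_nhdsWithin_iff.1 hφ] with z h1 h2 h3 using ⟨h1, h2 h3⟩
  obtain ⟨δ, hδ, hball⟩ := Metric.eventually_nhds_iff_ball.1 hgood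
  set r : ℝ := min 1 (δ / 2) with hr
  have hr0 : 0 < r := by positivity
  have hrδ : 2 * r ≤ δ := by linarith [min_le_right 1 (δ / 2)]
  set V : Set ℂ := (fun w ↦ e * w) '' cusp n r with hV
  have hVball : V ⊆ Metric.ball 0 δ := by
    rintro _ ⟨w, hw, rfl⟩
    have := norm_lt_of_mem_cusp (min_le_left _ _) hw
    simp only [mem_ball_zero_iff, norm_mul, hen, one_mul]
    linarith
  have hVt : V ⊆ f.target := fun ζ hζ ↦ (hball ζ (hVball hζ)).1
  have hVo : IsOpen V := (Homeomorph.mulLeft₀ e he0).isOpenMap _ (isOpen_cusp n r)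
  have hVc : IsConnected V := (isConnected_cusp n hr0).image _ (by fun_prop)
  have h0V : (0 : ℂ) ∈ closure V := by
    have := mem_closure_image (f := fun w ↦ e * w) (by fun_prop) (zero_mem_closure_cusp n hr0)
    simpa using this
  have hU : ∀ z ∈ f.symm '' V, z ≠ 0 ∧ ‖z‖ < 1 ∧ k z ≠ 0 ∧ φ z = C * g z ^ (-(n : ℤ)) ∧
      g z / e ∈ cusp n r := by
    rintro _ ⟨ζ, hζ, rfl⟩
    obtain ⟨h1, h2, h3⟩ := hball ζ (hVball hζ)
    have hgz : g (f.symm ζ) = ζ := f.right_inv h1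
    have hcusp : g (f.symm ζ) / e ∈ cusp n r := by
      obtain ⟨w, hw, rfl⟩ := hζ
      rwa [hgz, mul_div_cancel_left₀ _ he0]
    have hz0 : f.symm ζ ≠ 0 := fun h ↦ by
      have := hcusp.1
      simp [h, hg0] at this
    exact ⟨hz0, h2, (h3 hz0).1, (h3 hz0).2, hcusp⟩
  have h0U : (0 : ℂ) ∉ f.symm '' V := fun h ↦ (hU 0 h).1 rfl
  have hUo : IsOpen (f.symm '' V) := f.symm.isOpen_image_of_subset_source hVo hVt
  have hUc : IsConnected (f.symm '' V) := hVc.image _ (f.continuousOn_symm.mono hVt)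
  have hclos : (0 : ℂ) ∈ closure (f.symm '' V) := by
    have := hsymmc.continuousWithinAt.mem_closure_image h0V
    rwa [hsymm0] at this
  have harg : Tendsto (fun z : ℂ ↦ (z / e).arg) (𝓝[f.symm '' V] 0) (𝓝 0) := by
    have hm : Tendsto (fun z ↦ g z / e / (g z / e).re) (𝓝[f.symm '' V] 0) (𝓝 1) := by
      rw [tendsto_iff_norm_sub_tendsto_zero]
      have hgt : Tendsto (fun z ↦ ‖g z‖) (𝓝[f.symm '' V] 0) (𝓝 0) := by
        have := hgs.hasDerivAt.continuousAt.norm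
        rw [ContinuousAt, hg0, norm_zero] at this
        exact this.mono_left nhdsWithin_le_nhds
      refine squeeze_zero' (.of_forall fun _ ↦ norm_nonneg _) ?_ hgt
      filter_upwards [self_mem_nhdsWithin] with z hz
      have hcusp := (hU z hz).2.2.2.2
      refine (norm_div_re_sub_one_le hcusp).trans ?_
      refine (pow_le_of_le_one hcusp.1.le (hcusp.2.1.le.trans (min_le_left _ _)) hn.ne').trans ?_
      refine (Complex.re_le_norm _).trans ?_
      rw [norm_div, hen, div_one]
    have hkt : Tendsto k (𝓝[f.symm '' V] 0) (𝓝 1) := by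
      have := hk.continuousAt.tendsto
      rw [hk0] at this
      exact this.mono_left nhdsWithin_le_nhds
    have hq := hm.div hkt one_ne_zero
    rw [div_one] at hq
    have := (Complex.continuousAt_arg Complex.one_mem_slitPlane).tendsto.comp hq
    rw [Complex.arg_one] at this
    refine this.congr' ?_
    filter_upwards [self_mem_nhdsWithin] with z hz
    obtain ⟨-, -, hkz, -, hcusp⟩ := hU z hz
    have hre := hcusp.1
    have : z / e = ((g z / e).re : ℝ) * (g z / e / (g z / e).re / k z) := by
      have hc : (((g z / e).re : ℝ) : ℂ) ≠ 0 := by exact_mod_cast hre.ne'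
      rw [mul_div_assoc', mul_div_cancel₀ _ hc]
      simp only [hg]
      field_simp
    simp only [Function.comp_apply, Pi.div_apply]
    rw [this, Complex.arg_real_mul _ hre]
  refine ⟨f.symm '' V, hUo, ⟨hUc.nonempty, hUc, ?_, ⟨hclos, ?_⟩, ?_⟩,
    ‖C * e ^ (-(n : ℤ))‖ * n, fun z hz ↦ ?_⟩
  · exact Metric.isBounded_ball.subset (t := Metric.ball 0 1)
      fun z hz ↦ mem_ball_zero_iff.2 (hU z hz).2.1
  · rwa [hUo.interior_eq]
  · exact fun τ ε r' _ _ hr' hs ↦ exists_inter_subset_sector h0U harg hr' hs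
  · obtain ⟨-, -, -, hφz, hcusp⟩ := hU z hz
    convert abs_re_mul_zpow_le hC hcusp using 3
    rw [hφz, mul_assoc, ← mul_zpow, mul_div_cancel₀ _ he0]

/-- Near `0`, a function `C * z ^ (-n)` plus a polar polynomial of order `< n` is
`C * (z * k z) ^ (-n)` for an analytic `k` with `k 0 = 1`. -/
theorem exists_analyticAt_eq_mul_zpow {n : ℕ} (hn : 0 < n) {C : ℂ} (hC : C ≠ 0) (a : ℕ → ℂ) :
    ∃ k : ℂ → ℂ, AnalyticAt ℂ k 0 ∧ k 0 = 1 ∧ ∀ᶠ z in 𝓝[≠] (0 : ℂ),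
      C * z ^ (-(n : ℤ)) + polarPoly (n - 1) a z = C * (z * k z) ^ (-(n : ℤ)) := by
  set h : ℂ → ℂ := fun z ↦ 1 + C⁻¹ * ∑ j ∈ Finset.Icc 1 (n - 1), a j * z ^ (n - j) with hh
  have hh0 : h 0 = 1 := by
    have : ∑ j ∈ Finset.Icc 1 (n - 1), a j * (0 : ℂ) ^ (n - j) = 0 := by
      refine Finset.sum_eq_zero fun j hj ↦ ?_
      rw [Finset.mem_Icc] at hj
      rw [zero_pow (by omega), mul_zero]
    simp only [hh, this, mul_zero, add_zero]
  have hha : AnalyticAt ℂ h 0 := by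
    refine analyticAt_const.add (analyticAt_const.mul ?_)
    exact Finset.analyticAt_fun_sum _ fun j _ ↦ analyticAt_const.mul (analyticAt_id.pow _)
  have hn' : (n : ℂ) ≠ 0 := by exact_mod_cast hn.ne'
  refine ⟨fun z ↦ Complex.exp (-(Complex.log (h z) / n)), ?_, by simp [hh0], ?_⟩
  · exact ((hha.clog (by simp [hh0])).div analyticAt_const hn').neg.cexp
  · have hne : ∀ᶠ z in 𝓝[≠] (0 : ℂ), h z ≠ 0 :=
      (hha.continuousAt.eventually_ne (by simp [hh0])).filter_mono nhdsWithin_le_nhds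
    filter_upwards [hne, self_mem_nhdsWithin] with z hz hz0
    replace hz0 : z ≠ 0 := hz0
    have hexp : Complex.exp (-(Complex.log (h z) / n)) ^ (-(n : ℤ)) = h z := by
      rw [← Complex.exp_int_mul]
      convert Complex.exp_log hz using 2
      push_cast
      field_simp
    rw [mul_zpow, hexp, hh, polarPoly]
    have hsum : ∑ j ∈ Finset.Icc 1 (n - 1), a j * z ^ (-(j : ℤ)) =
        z ^ (-(n : ℤ)) * ∑ j ∈ Finset.Icc 1 (n - 1), a j * z ^ (n - j) := by
      rw [Finset.mul_sum]
      refine Finset.sum_congr rfl fun j hj ↦ ?_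
      rw [Finset.mem_Icc] at hj
      rw [mul_left_comm, ← zpow_natCast z (n - j), ← zpow_add₀ hz0]
      congr 2
      omega
    rw [hsum]
    field_simp

/-- For every `n ≥ 1` and `τ₀ ∈ ℝ` there is `τ ∈ ℝ` such that for
every `ρ > 0` and every polar polynomial `φ̃` of order `< n`, setting
`φ(z) = ρ e^{iτ₀} z^{−n} + φ̃(z)`, there are open sets `U₀, …, U_{2n−1}` with
`U_j` concentrated along `τ + jπ/n` and both `Re φ` and `−Re φ` bounded above
on `U_j`. -/
theorem exists_concentrated_sets_with_pm_re_bddAbove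
    (n : ℕ) (hn : 0 < n) (τ₀ : ℝ) :
    ∃ τ : ℝ, ∀ ρ : ℝ, 0 < ρ → ∀ a : ℕ → ℂ, ∀ φ : ℂ → ℂ,
      (∀ z : ℂ, φ z =
        (ρ : ℂ) * Complex.exp (τ₀ * Complex.I) * z ^ (-(n : ℤ)) + polarPoly (n - 1) a z) →
      ∃ U : Fin (2 * n) → Set ℂ, ∀ j : Fin (2 * n),
        IsOpen (U j) ∧
        ConcentratedAlong (U j) (τ + (j : ℕ) * π / n) ∧
        (∃ B : ℝ, ∀ z ∈ U j, (φ z).re ≤ B) ∧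
        (∃ B : ℝ, ∀ z ∈ U j, -(φ z).re ≤ B) := by
  have hn' : (n : ℂ) ≠ 0 := by exact_mod_cast hn.ne'
  refine ⟨(τ₀ + π / 2) / n, fun ρ hρ a φ hφ ↦ ?_⟩
  have hC : (ρ : ℂ) * Complex.exp (τ₀ * Complex.I) ≠ 0 :=
    mul_ne_zero (by exact_mod_cast hρ.ne') (Complex.exp_ne_zero _)
  obtain ⟨k, hk, hk0, hkφ⟩ := exists_analyticAt_eq_mul_zpow hn hC a
  have key (j : Fin (2 * n)) := by
    refine exists_concentratedAlong_abs_re_le (θ := (τ₀ + π / 2) / n + (j : ℕ) * π / n) (φ := φ)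
      hn ?_ hk hk0 (hkφ.mono fun z hz ↦ (hφ z).trans hz)
    have harg : (τ₀ : ℂ) * Complex.I + ((-(n : ℤ) : ℤ) : ℂ) *
        ((((τ₀ + π / 2) / n + (j : ℕ) * π / n : ℝ) : ℂ) * Complex.I) =
        ((-(π / 2 + (j : ℕ) * π) : ℝ) : ℂ) * Complex.I := by
      push_cast
      field_simp
      ring
    rw [← Complex.exp_int_mul, mul_assoc, ← Complex.exp_add, harg, Complex.re_ofReal_mul,
      Complex.exp_ofReal_mul_I_re, Real.cos_neg, Real.cos_add_nat_mul_pi]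
    simp
  choose U hUo hUc B hB using key
  exact ⟨U, fun j ↦ ⟨hUo j, hUc j, ⟨B j, fun z hz ↦ (le_abs_self _).trans (hB j z hz)⟩,
    ⟨B j, fun z hz ↦ (neg_le_abs _).trans (hB j z hz)⟩⟩⟩
end

section
/- Let φ₁, φ₂ be nonzero polar polynomials, and suppose that φ₁ ≠ λ φ₂ for every λ ∈ ℝ_{>0}. Then for every open neighborhood S of 0 in ℂ, both of the following hold: (a) there exists a nonempty bounded open set U ⊆ S such that Re φ₁ is bounded above on U and Re φ₂ is not bounded above on U; (b) there exists a nonempty bounded open set V ⊆ S such that Re φ₂ is bounded above on V and Re φ₁ is not bounded above on V. -/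
open scoped Real

open Polynomial Filter in
/-- Along rays, the sign of the real part of a polynomial is governed by its leading term,
uniformly in the direction. -/
theorem eventually_lt_re_eval_of_le_re_leading (P : ℂ[X]) (hP : 0 < P.natDegree)
    {c : ℝ} (hc : 0 < c) (B : ℝ) :
    ∀ᶠ R : ℝ in atTop, ∀ u : ℂ, ‖u‖ = 1 → c ≤ (P.leadingCoeff * u ^ P.natDegree).re →
      B < (P.eval (R * u)).re := by
  set K : ℝ := ∑ j ∈ Finset.range P.natDegree, ‖P.coeff j‖
  have hlim : Tendsto (fun R : ℝ => c * R - K) atTop atTop :=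
    tendsto_atTop_add_const_right _ _ (tendsto_id.const_mul_atTop hc)
  filter_upwards [eventually_ge_atTop 1, hlim.eventually_gt_atTop |B|] with R hR hRB u hu hcu
  obtain ⟨d, hd⟩ : ∃ d, P.natDegree = d + 1 := ⟨P.natDegree - 1, by omega⟩
  have hlow : ‖∑ j ∈ Finset.range P.natDegree, P.coeff j * ((R : ℂ) * u) ^ j‖ ≤ K * R ^ d := by
    rw [Finset.sum_mul]
    refine norm_sum_le_of_le _ fun j hj => ?_
    rw [norm_mul, norm_pow, norm_mul, hu, mul_one, Complex.norm_real, Real.norm_eq_abs,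
      abs_of_nonneg (by linarith)]
    have hjd : j ≤ d := by
      have := Finset.mem_range.1 hj
      omega
    gcongr
  have heval : (P.eval (R * u)).re
      = (∑ j ∈ Finset.range P.natDegree, P.coeff j * ((R : ℂ) * u) ^ j).re
        + R ^ P.natDegree * (P.leadingCoeff * u ^ P.natDegree).re := by
    rw [eval_eq_sum_range, Finset.sum_range_succ, Complex.add_re, ← Complex.re_ofReal_mul]
    congr 2
    push_cast [mul_pow]
    rw [coeff_natDegree]
    ring
  have hre := (abs_le.1 ((Complex.abs_re_le_norm _).trans hlow)).1
  have hlead : R ^ P.natDegree * c ≤ R ^ P.natDegree * (P.leadingCoeff * u ^ P.natDegree).re := by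
    gcongr
  have hpow : 1 ≤ R ^ d := one_le_pow₀ hR
  rw [heval]
  calc B ≤ |B| := le_abs_self B
    _ < c * R - K := hRB
    _ ≤ R ^ d * (c * R - K) :=
      le_mul_of_one_le_left ((abs_nonneg B).trans hRB.le) hpow
    _ = -(K * R ^ d) + R ^ P.natDegree * c := by rw [hd]; ring
    _ ≤ _ := add_le_add hre hlead

open Polynomial Filter in
theorem eventually_re_eval_lt_of_re_leading_le (P : ℂ[X]) (hP : 0 < P.natDegree)
    {c : ℝ} (hc : 0 < c) (B : ℝ) :
    ∀ᶠ R : ℝ in atTop, ∀ u : ℂ, ‖u‖ = 1 → (P.leadingCoeff * u ^ P.natDegree).re ≤ -c →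
      (P.eval (R * u)).re < B := by
  filter_upwards [eventually_lt_re_eval_of_le_re_leading (-P) (by simpa using hP) hc (-B)]
    with R hR u hu hcu
  have := hR u hu (by
    rw [leadingCoeff_neg, natDegree_neg, neg_mul, Complex.neg_re]
    linarith)
  rw [eval_neg, Complex.neg_re] at this
  linarith

theorem re_mul_exp_pow (a : ℂ) (n : ℕ) (θ : ℝ) :
    (a * Complex.exp (θ * Complex.I) ^ n).re = ‖a‖ * Real.cos (a.arg + n * θ) := by
  conv_lhs => rw [← Complex.norm_mul_exp_arg_mul_I a]
  rw [← Complex.exp_nat_mul, mul_assoc, ← Complex.exp_add, Complex.re_ofReal_mul]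
  congr 1
  rw [show (a.arg : ℂ) * Complex.I + n * (θ * Complex.I) = ((a.arg + n * θ : ℝ) : ℂ) * Complex.I by
    push_cast; ring]
  exact Complex.exp_ofReal_mul_I_re _

/-- An oscillation of frequency `q ≥ p` that is nonpositive on an open half-period of frequency `p`
has frequency exactly `p` and its minimum at the centre. -/
theorem eq_and_cos_eq_neg_one_of_cos_nonpos {p q : ℕ} (hp : 0 < p) (hpq : p ≤ q) {γ : ℝ}
    (h : ∀ x : ℝ, |x| * p < q * (π / 2) → Real.cos (γ + x) ≤ 0) :
    p = q ∧ Real.cos γ = -1 := by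
  have hp' : (0 : ℝ) < p := by exact_mod_cast hp
  have hpq' : (p : ℝ) ≤ q := by exact_mod_cast hpq
  have hopen : ∀ x ∈ Set.Ioo (-(π / 2)) (π / 2), Real.cos (γ + x) ≤ 0 := fun x hx => by
    apply h
    have := abs_lt.2 hx
    have := Real.pi_pos
    nlinarith
  have hclosed : ∀ x ∈ Set.Icc (-(π / 2)) (π / 2), Real.cos (γ + x) ≤ 0 := by
    rw [← closure_Ioo (by linarith [Real.pi_pos] : -(π / 2) ≠ π / 2)]
    have hcont : Continuous fun x => Real.cos (γ + x) := by fun_prop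
    exact fun x hx => closure_minimal hopen (isClosed_le hcont continuous_const) hx
  have hpi := Real.pi_pos
  have h1 := hclosed (π / 2) ⟨by linarith, le_rfl⟩
  have h2 := hclosed (-(π / 2)) ⟨le_rfl, by linarith⟩
  have h3 := hclosed 0 ⟨by linarith, by linarith⟩
  rw [Real.cos_add_pi_div_two] at h1
  rw [← sub_eq_add_neg, Real.cos_sub_pi_div_two] at h2
  rw [add_zero] at h3
  have hsin : Real.sin γ = 0 := by linarith
  have hcos : Real.cos γ = -1 := by
    nlinarith [Real.sin_sq_add_cos_sq γ]
  refine ⟨hpq.antisymm (not_lt.1 fun hlt => ?_), hcos⟩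
  have hlt' : (p : ℝ) < q := by exact_mod_cast hlt
  obtain ⟨x, hx1, hx2⟩ : ∃ x, π / 2 < x ∧ x < min (q * (π / 2) / p) π :=
    exists_between (lt_min (by rw [lt_div_iff₀ hp']; nlinarith) (by linarith))
  have hx3 := h x (by
    rw [abs_of_pos (by linarith)]
    exact (lt_div_iff₀ hp').1 (hx2.trans_le (min_le_left _ _)))
  rw [Real.cos_add, hcos, hsin] at hx3
  have := Real.cos_neg_of_pi_div_two_lt_of_lt hx1
    (by linarith [hx2.trans_le (min_le_right _ _)])
  linarith

/-- If the cosine `cos (β + qθ)` is nonpositive wherever `cos (α + pθ)` is negative, then the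
two functions coincide. -/
theorem eq_and_cos_sub_eq_one_of_cos_nonpos {p q : ℕ} (hp : 0 < p) (hq : 0 < q) {α β : ℝ}
    (h : ∀ θ : ℝ, Real.cos (α + p * θ) < 0 → Real.cos (β + q * θ) ≤ 0) :
    p = q ∧ Real.cos (α - β) = 1 := by
  have hp' : (0 : ℝ) < p := by exact_mod_cast hp
  have hq' : (0 : ℝ) < q := by exact_mod_cast hq
  have hpi := Real.pi_pos
  have hqp : p ≤ q := by
    by_contra! hlt
    refine hlt.ne (eq_and_cos_eq_neg_one_of_cos_nonpos (γ := α - p * (β / q) + π) hq hlt.le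
      fun x hx => ?_).1
    rw [add_right_comm, Real.cos_add_pi]
    have hx' : |x * q / p| < π / 2 := by
      rw [abs_div, abs_mul, abs_of_pos hq', abs_of_pos hp', div_lt_iff₀ hp']
      linarith
    have hpos := Real.cos_pos_of_mem_Ioo (abs_lt.1 hx')
    by_contra! hneg
    have := h (x / p - β / q) (by
      rw [show α + p * (x / p - β / q) = α - p * (β / q) + x by field_simp; ring]
      linarith)
    rw [show β + q * (x / p - β / q) = x * q / p by field_simp; ring] at this
    linarith
  obtain ⟨rfl, hcos⟩ := eq_and_cos_eq_neg_one_of_cos_nonpos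
    (γ := β + q * ((π - α) / p)) hp hqp fun x hx => by
      have hx' : |x * p / q| < π / 2 := by
        rw [abs_div, abs_mul, abs_of_pos hq', abs_of_pos hp', div_lt_iff₀ hq']
        linarith
      have hpos := Real.cos_pos_of_mem_Ioo (abs_lt.1 hx')
      have := h ((π - α) / p + x / q) (by
        rw [show α + p * ((π - α) / p + x / q) = x * p / q + π by field_simp; ring,
          Real.cos_add_pi]
        linarith)
      rwa [show β + q * ((π - α) / p + x / q) = β + q * ((π - α) / p) + x by
        field_simp; ring] at this
  refine ⟨rfl, ?_⟩
  rw [show β + p * ((π - α) / p) = π - (α - β) by field_simp; ring, Real.cos_pi_sub] at hcos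
  linarith

/-- Among the zeros of `cos (α + pθ)`, some make an oscillation of lower frequency negative. -/
theorem exists_cos_eq_zero_and_cos_neg {p m : ℕ} (hm : 0 < m) (hmp : m < p) (α γ : ℝ) :
    ∃ θ : ℝ, Real.cos (α + p * θ) = 0 ∧ Real.cos (γ + m * θ) < 0 := by
  have hm' : (0 : ℝ) < m := by exact_mod_cast hm
  have hmp' : (m : ℝ) < p := by exact_mod_cast hmp
  have hp' : (0 : ℝ) < p := hm'.trans hmp'
  have hpi := Real.pi_pos
  obtain ⟨k, hk, -⟩ := existsUnique_add_zsmul_mem_Ioc (show 0 < m * π / p by positivity)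
    (γ + m * ((π / 2 - α) / p)) (π / 2)
  refine ⟨(π / 2 - α + k * π) / p, ?_, ?_⟩
  · rw [Real.cos_eq_zero_iff]
    exact ⟨k, by field_simp; ring⟩
  · have hstep : m * π / p < π := by
      rw [div_lt_iff₀ hp']
      nlinarith
    rw [show γ + m * ((π / 2 - α + k * π) / p)
      = γ + m * ((π / 2 - α) / p) + k • (m * π / p) by rw [zsmul_eq_mul]; field_simp; ring]
    exact Real.cos_neg_of_pi_div_two_lt_of_lt hk.1 (by linarith [hk.2])

theorem exists_pos_eq_mul_of_cos_arg_sub_eq_one {a b : ℂ} (ha : a ≠ 0) (hb : b ≠ 0)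
    (h : Real.cos (a.arg - b.arg) = 1) : ∃ lam : ℝ, 0 < lam ∧ a = lam * b := by
  obtain ⟨k, hk⟩ := (Real.cos_eq_one_iff _).1 h
  have hb' : (‖b‖ : ℂ) ≠ 0 := by simpa using hb
  refine ⟨‖a‖ / ‖b‖, by positivity, ?_⟩
  have hexp : Complex.exp (a.arg * Complex.I) = Complex.exp (b.arg * Complex.I) :=
    Complex.exp_eq_exp_iff_exists_int.2 ⟨k, by
      rw [show a.arg = b.arg + k * (2 * π) by linarith]
      push_cast
      ring⟩
  conv_lhs => rw [← Complex.norm_mul_exp_arg_mul_I a, hexp]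
  conv_rhs => rw [← Complex.norm_mul_exp_arg_mul_I b]
  push_cast
  simp only [norm_mul, Complex.norm_real, norm_norm, Complex.norm_exp_ofReal_mul_I, mul_one]
  field_simp

open Polynomial Filter in
theorem exists_re_eval_eq_zero_of_cos_eq_zero (P : ℂ[X]) (hP : 0 < P.natDegree)
    {θ₀ δ : ℝ} (hδ : 0 < δ) (hPδ : P.natDegree * δ < π)
    (hθ₀ : Real.cos (P.leadingCoeff.arg + P.natDegree * θ₀) = 0) :
    ∀ᶠ R : ℝ in atTop, ∃ θ : ℝ, |θ - θ₀| ≤ δ ∧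
      (P.eval (R * Complex.exp (θ * Complex.I))).re = 0 := by
  have hP' : (0 : ℝ) < P.natDegree := by exact_mod_cast hP
  have ha : 0 < ‖P.leadingCoeff‖ := by
    simpa using fun h : P = 0 => by simp [h] at hP
  set p : ℝ := (P.natDegree : ℝ)
  set α := P.leadingCoeff.arg
  have hs : 0 < Real.sin (p * δ) := Real.sin_pos_of_pos_of_lt_pi (by positivity) hPδ
  have hc : 0 < ‖P.leadingCoeff‖ * Real.sin (p * δ) := by positivity
  have hadd : Real.cos (α + p * (θ₀ + δ)) = -(Real.sin (α + p * θ₀) * Real.sin (p * δ)) := by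
    rw [mul_add, ← add_assoc, Real.cos_add, hθ₀]
    ring
  have hsub : Real.cos (α + p * (θ₀ - δ)) = Real.sin (α + p * θ₀) * Real.sin (p * δ) := by
    rw [mul_sub, ← add_sub_assoc, Real.cos_sub, hθ₀]
    ring
  have hsin : Real.sin (α + p * θ₀) = 1 ∨ Real.sin (α + p * θ₀) = -1 := by
    rw [← sq_eq_one_iff]
    nlinarith [Real.sin_sq_add_cos_sq (α + p * θ₀)]
  filter_upwards [eventually_lt_re_eval_of_le_re_leading P hP hc 0,
    eventually_re_eval_lt_of_re_leading_le P hP hc 0] with R hpos hneg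
  set f : ℝ → ℝ := fun θ => (P.eval (R * Complex.exp (θ * Complex.I))).re
  have hf : Continuous f := by
    have := P.continuous
    fun_prop
  have hmem : (0 : ℝ) ∈ Set.uIcc (f (θ₀ - δ)) (f (θ₀ + δ)) := by
    have hu := Complex.norm_exp_ofReal_mul_I
    rcases hsin with h | h <;> rw [h] at hadd hsub
    · exact Set.mem_uIcc_of_ge
        (hneg _ (hu _) (by rw [re_mul_exp_pow, hadd]; linarith)).le
        (hpos _ (hu _) (by rw [re_mul_exp_pow, hsub]; linarith)).le
    · exact Set.mem_uIcc_of_le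
        (hneg _ (hu _) (by rw [re_mul_exp_pow, hsub]; linarith)).le
        (hpos _ (hu _) (by rw [re_mul_exp_pow, hadd]; linarith)).le
  obtain ⟨θ, hθ, hfθ⟩ := intermediate_value_uIcc hf.continuousOn hmem
  rw [Set.uIcc_of_le (by linarith)] at hθ
  exact ⟨θ, abs_le.2 ⟨by linarith [hθ.1], by linarith [hθ.2]⟩, hfθ⟩

open Polynomial Filter in
/-- Two nonconstant polynomials without constant term, the first of which is not a positive
multiple of the second: where the real part of the first is bounded above, that of the second
is not. -/
theorem exists_re_eval_lt_one_and_lt_re_eval (P Q : ℂ[X]) (hP : 0 < P.natDegree)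
    (hQ : 0 < Q.natDegree) (hP0 : P.coeff 0 = 0) (hQ0 : Q.coeff 0 = 0)
    (hPQ : ¬ ∃ lam : ℝ, 0 < lam ∧ P = C (lam : ℂ) * Q) (B : ℝ) :
    ∃ w : ℂ, (P.eval w).re < 1 ∧ B < (Q.eval w).re := by
  have haP : P.leadingCoeff ≠ 0 := leadingCoeff_ne_zero.2 fun h => by simp [h] at hP
  have haQ : Q.leadingCoeff ≠ 0 := leadingCoeff_ne_zero.2 fun h => by simp [h] at hQ
  by_cases hray : ∃ θ : ℝ, Real.cos (P.leadingCoeff.arg + P.natDegree * θ) < 0 ∧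
      0 < Real.cos (Q.leadingCoeff.arg + Q.natDegree * θ)
  · obtain ⟨θ, hθP, hθQ⟩ := hray
    have hcP : 0 < -(‖P.leadingCoeff‖ * Real.cos (P.leadingCoeff.arg + P.natDegree * θ)) :=
      neg_pos.2 (mul_neg_of_pos_of_neg (norm_pos_iff.2 haP) hθP)
    have hcQ := mul_pos (norm_pos_iff.2 haQ) hθQ
    obtain ⟨R, hRP, hRQ⟩ := ((eventually_re_eval_lt_of_re_leading_le P hP hcP 1).and
      (eventually_lt_re_eval_of_le_re_leading Q hQ hcQ B)).exists
    have hu := Complex.norm_exp_ofReal_mul_I θ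
    exact ⟨_, hRP _ hu (by rw [re_mul_exp_pow, neg_neg]), hRQ _ hu (by rw [re_mul_exp_pow])⟩
  push Not at hray
  obtain ⟨hdeg, hcos⟩ := eq_and_cos_sub_eq_one_of_cos_nonpos hP hQ hray
  obtain ⟨lam, hlam, hlead⟩ := exists_pos_eq_mul_of_cos_arg_sub_eq_one haP haQ hcos
  have hlamC : (lam : ℂ) ≠ 0 := by exact_mod_cast hlam.ne'
  set D := P - C (lam : ℂ) * Q with hD
  have hDne : D ≠ 0 := fun h => hPQ ⟨lam, hlam, sub_eq_zero.1 h⟩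
  have hDpos : 0 < D.natDegree := Nat.pos_of_ne_zero fun h => hDne <| by
    rw [eq_C_of_natDegree_eq_zero h, hD]
    simp [hP0, hQ0]
  have hDlt : D.natDegree < P.natDegree := natDegree_lt_natDegree hDne <|
    degree_sub_lt_left (by
      rw [degree_C_mul hlamC, degree_eq_natDegree (leadingCoeff_ne_zero.1 haP),
        degree_eq_natDegree (leadingCoeff_ne_zero.1 haQ), hdeg])
      (leadingCoeff_ne_zero.1 haP) (by rw [leadingCoeff_mul, leadingCoeff_C, hlead])
  obtain ⟨θ₀, hθP, hθD⟩ := exists_cos_eq_zero_and_cos_neg hDpos hDlt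
    P.leadingCoeff.arg D.leadingCoeff.arg
  obtain ⟨c, hc1, hc0⟩ := exists_between hθD
  obtain ⟨η, hη, hball⟩ := Metric.eventually_nhds_iff.1
    ((by fun_prop : Continuous fun θ : ℝ =>
      Real.cos (D.leadingCoeff.arg + D.natDegree * θ)).continuousAt.eventually_lt
        continuousAt_const hc1)
  have hp' : (0 : ℝ) < P.natDegree := by exact_mod_cast hP
  obtain ⟨δ, hδ, hδmin⟩ : ∃ δ, 0 < δ ∧ δ < min η (π / P.natDegree) :=
    exists_between (lt_min hη (div_pos Real.pi_pos hp'))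
  have hPδ : P.natDegree * δ < π := by
    rw [mul_comm]
    exact (lt_div_iff₀ hp').1 (hδmin.trans_le (min_le_right _ _))
  have hd : 0 < ‖D.leadingCoeff‖ * -c :=
    mul_pos (norm_pos_iff.2 (leadingCoeff_ne_zero.2 hDne)) (neg_pos.2 hc0)
  obtain ⟨R, hRD, θ, hθ, hzero⟩ :=
    ((eventually_re_eval_lt_of_re_leading_le D hDpos hd (-(lam * B))).and
      (exists_re_eval_eq_zero_of_cos_eq_zero P hP hδ hPδ hθP)).exists
  refine ⟨R * Complex.exp (θ * Complex.I), by rw [hzero]; exact one_pos, ?_⟩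
  have hDval := hRD _ (Complex.norm_exp_ofReal_mul_I θ) (by
    rw [re_mul_exp_pow, mul_neg, neg_neg]
    have := hball (hθ.trans_lt (hδmin.trans_le (min_le_left _ _)))
    gcongr)
  rw [hD, eval_sub, eval_C_mul, Complex.sub_re, Complex.re_ofReal_mul, hzero] at hDval
  exact lt_of_mul_lt_mul_left (by linarith) hlam.le

open Polynomial in
/-- The polynomial in `z⁻¹` that represents `polarPoly n a`. -/
noncomputable def polarPolynomial (n : ℕ) (a : ℕ → ℂ) : ℂ[X] :=
  ∑ j ∈ Finset.Icc 1 n, C (a j) * X ^ j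

open Polynomial in
theorem eval_polarPolynomial (n : ℕ) (a : ℕ → ℂ) (w : ℂ) :
    (polarPolynomial n a).eval w = polarPoly n a w⁻¹ := by
  simp [polarPolynomial, polarPoly, eval_finsetSum]

open Polynomial in
theorem coeff_polarPolynomial (n : ℕ) (a : ℕ → ℂ) (k : ℕ) :
    (polarPolynomial n a).coeff k = if k ∈ Finset.Icc 1 n then a k else 0 := by
  simp only [polarPolynomial, finsetSum_coeff, coeff_C_mul_X_pow, Finset.sum_ite_eq]

open Polynomial in
theorem natDegree_polarPolynomial_pos {n : ℕ} (hn : 0 < n) {a : ℕ → ℂ} (ha : a n ≠ 0) :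
    0 < (polarPolynomial n a).natDegree := by
  refine hn.trans_le (le_natDegree_of_ne_zero ?_)
  rwa [coeff_polarPolynomial, if_pos (Finset.mem_Icc.2 ⟨hn, le_rfl⟩)]

open Polynomial in
theorem exists_separating_set_in_neighborhood
    (n₁ n₂ : ℕ) (hn₁ : 0 < n₁) (hn₂ : 0 < n₂)
    (a₁ a₂ : ℕ → ℂ) (ha₁ : a₁ n₁ ≠ 0) (ha₂ : a₂ n₂ ≠ 0)
    (hprop : ¬ ∃ lam : ℝ, 0 < lam ∧
      ∀ z : ℂ, z ≠ 0 → polarPoly n₁ a₁ z = (lam : ℂ) * polarPoly n₂ a₂ z)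
    (S : Set ℂ) (hSopen : IsOpen S) (hS0 : (0 : ℂ) ∈ S) :
    ∃ U : Set ℂ, U.Nonempty ∧ IsOpen U ∧ Bornology.IsBounded U ∧ U ⊆ S ∧
      (∃ B : ℝ, ∀ z ∈ U, (polarPoly n₁ a₁ z).re ≤ B) ∧
      ¬ (∃ B : ℝ, ∀ z ∈ U, (polarPoly n₂ a₂ z).re ≤ B) := by
  set P := polarPolynomial n₁ a₁ with hPdef
  set Q := polarPolynomial n₂ a₂ with hQdef
  have hPQ : ¬ ∃ lam : ℝ, 0 < lam ∧ P = C (lam : ℂ) * Q := by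
    rintro ⟨lam, hlam, h⟩
    refine hprop ⟨lam, hlam, fun z _ => ?_⟩
    have := congrArg (eval z⁻¹) h
    rwa [eval_C_mul, eval_polarPolynomial, eval_polarPolynomial, inv_inv] at this
  obtain ⟨r, hr, hrS⟩ := Metric.isOpen_iff.1 hSopen 0 hS0
  set U : Set ℂ := Metric.ball 0 r ∩ {z | z ≠ 0 ∧ (P.eval z⁻¹).re < 1} with hU
  have hpunctured : ∀ B : ℝ, ∃ z ∈ U, B < (polarPoly n₂ a₂ z).re := fun B => by
    obtain ⟨M, hM⟩ := (isCompact_closedBall (0 : ℂ) r⁻¹).bddAbove_image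
      (f := fun w => (Q.eval w).re) (Complex.continuous_re.comp Q.continuous).continuousOn
    obtain ⟨w, hwP, hwQ⟩ := exists_re_eval_lt_one_and_lt_re_eval P Q
      (natDegree_polarPolynomial_pos hn₁ ha₁) (natDegree_polarPolynomial_pos hn₂ ha₂)
      (by simp [hPdef, coeff_polarPolynomial]) (by simp [hQdef, coeff_polarPolynomial])
      hPQ (max B M)
    have hw : r⁻¹ < ‖w‖ := by
      by_contra! hle
      exact ((le_max_right B M).trans_lt hwQ).not_ge
        (hM (Set.mem_image_of_mem _ (mem_closedBall_zero_iff.2 hle)))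
    have hw0 : 0 < ‖w‖ := (inv_pos.2 hr).trans hw
    refine ⟨w⁻¹, ⟨?_, inv_ne_zero (norm_pos_iff.1 hw0), by rwa [inv_inv]⟩, ?_⟩
    · rw [mem_ball_zero_iff, norm_inv]
      exact inv_lt_of_inv_lt₀ hr hw
    · rw [← eval_polarPolynomial]
      exact (le_max_left B M).trans_lt hwQ
  refine ⟨U, ?_, ?_, Metric.isBounded_ball.subset Set.inter_subset_left,
    Set.inter_subset_left.trans hrS, ⟨1, fun z hz => ?_⟩, ?_⟩
  · obtain ⟨z, hz, -⟩ := hpunctured 0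
    exact ⟨z, hz⟩
  · have hcont : ContinuousOn (fun z : ℂ => (P.eval z⁻¹).re) {0}ᶜ :=
      Complex.continuous_re.comp_continuousOn
        (P.continuous.comp_continuousOn (continuousOn_inv₀))
    exact Metric.isOpen_ball.inter
      (hcont.isOpen_inter_preimage isOpen_compl_singleton (isOpen_Iio (a := (1 : ℝ))))
  · have := hz.2.2.le
    rwa [eval_polarPolynomial, inv_inv] at this
  · rintro ⟨B, hB⟩
    obtain ⟨z, hz, hlt⟩ := hpunctured B
    exact hlt.not_ge (hB z hz)

/-- Let `φ₁, φ₂` be nonzero polar polynomials, not positive real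
multiples of each other.  Then in every open neighborhood `S` of `0` there
exist both separating open sets: a nonempty bounded open `U ⊆ S` on which
`Re φ₁` is bounded above but `Re φ₂` is not, and a nonempty bounded open
`V ⊆ S` on which `Re φ₂` is bounded above but `Re φ₁` is not. -/
theorem exists_separating_sets_in_neighborhood
    (n₁ n₂ : ℕ) (hn₁ : 0 < n₁) (hn₂ : 0 < n₂)
    (a₁ a₂ : ℕ → ℂ) (ha₁ : a₁ n₁ ≠ 0) (ha₂ : a₂ n₂ ≠ 0)
    (hprop : ¬ ∃ lam : ℝ, 0 < lam ∧
      ∀ z : ℂ, z ≠ 0 → polarPoly n₁ a₁ z = (lam : ℂ) * polarPoly n₂ a₂ z)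
    (S : Set ℂ) (hSopen : IsOpen S) (hS0 : (0 : ℂ) ∈ S) :
    (∃ U : Set ℂ, U.Nonempty ∧ IsOpen U ∧ Bornology.IsBounded U ∧ U ⊆ S ∧
        (∃ B : ℝ, ∀ z ∈ U, (polarPoly n₁ a₁ z).re ≤ B) ∧
        ¬ (∃ B : ℝ, ∀ z ∈ U, (polarPoly n₂ a₂ z).re ≤ B))
      ∧
    (∃ V : Set ℂ, V.Nonempty ∧ IsOpen V ∧ Bornology.IsBounded V ∧ V ⊆ S ∧
        (∃ B : ℝ, ∀ z ∈ V, (polarPoly n₂ a₂ z).re ≤ B) ∧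
        ¬ (∃ B : ℝ, ∀ z ∈ V, (polarPoly n₁ a₁ z).re ≤ B)) := by
  refine ⟨exists_separating_set_in_neighborhood n₁ n₂ hn₁ hn₂ a₁ a₂ ha₁ ha₂ hprop S hSopen hS0,
    exists_separating_set_in_neighborhood n₂ n₁ hn₂ hn₁ a₂ a₁ ha₂ ha₁ ?_ S hSopen hS0⟩
  rintro ⟨lam, hlam, h⟩
  refine hprop ⟨lam⁻¹, inv_pos.2 hlam, fun z hz => ?_⟩
  have hlamC : (lam : ℂ) ≠ 0 := by exact_mod_cast hlam.ne'
  rw [h z hz, Complex.ofReal_inv, inv_mul_cancel_left₀ hlamC]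
end
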